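/- arXiv:2403.00838 — 6 statements merged into one kernel-verified Lean document; each statement's English description precedes it below -/
import Mathlib

section
/- Let W : (0,∞) → [0,∞) be continuously differentiable, nonnegative, convex on (0,1), with W(1) = 0, and let W*(H) := H·W(1/H) for H > 0, extended by W*(0) := 0. Let 0 < λ ≤ 1 and ε > 0. Then for every H ∈ H¹(0,λ) (absolutely continuous with square-integrable derivative) satisfying H ≥ 0 a.e. and ∫₀^λ H(y) dy = 1, one has E_ε[H] := ∫₀^λ ( (ε²/2)(H′(y))² + W*(H(y)) ) dy ≥ λ·W*(1/λ). Moreover the constant function H ≡ 1/λ is admissible and attains this value, hence it minimizes E_ε over the admissible class. -/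
open MeasureTheory Set intervalIntegral

/-- The graph of a convex function lies above its tangent line. -/
theorem ConvexOn.add_deriv_mul_sub_le_of_hasDerivAt {S : Set ℝ} {f : ℝ → ℝ} {x y m : ℝ}
    (hf : ConvexOn ℝ S f) (hx : x ∈ S) (hy : y ∈ S) (hm : HasDerivAt f m x) :
    f x + m * (y - x) ≤ f y := by
  rcases lt_trichotomy x y with h | rfl | h
  · have := hf.le_slope_of_hasDerivAt hx hy h hm
    rw [slope_def_field, le_div_iff₀ (sub_pos.2 h)] at this
    linarith
  · simp
  · have := hf.slope_le_of_hasDerivAt hy hx h hm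
    rw [slope_def_field, div_le_iff₀ (sub_pos.2 h)] at this
    linarith

/-- A nonnegative function on `(0, ∞)` that is convex on `(0, 1)` and vanishes at `1` has a
nonincreasing global affine support at every point of `(0, 1]`. -/
theorem exists_nonpos_slope_affine_support {W : ℝ → ℝ} {a : ℝ} (ha0 : 0 < a) (ha1 : a ≤ 1)
    (hC1 : ContDiffOn ℝ 1 W (Ioi 0)) (hnonneg : ∀ F : ℝ, 0 < F → 0 ≤ W F)
    (hconvex : ConvexOn ℝ (Ioo (0 : ℝ) 1) W) (hone : W 1 = 0) :
    ∃ m ≤ 0, ∀ F, 0 < F → W a + m * (F - a) ≤ W F := by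
  rcases ha1.eq_or_lt with rfl | ha1
  · exact ⟨0, le_rfl, fun F hF => by simpa [hone] using hnonneg F hF⟩
  have hderiv : HasDerivAt W (deriv W a) a :=
    ((hC1.contDiffAt (Ioi_mem_nhds ha0)).differentiableAt one_ne_zero).hasDerivAt
  have htangent (y : ℝ) (hy : y ∈ Ioo (0 : ℝ) 1) : W a + deriv W a * (y - a) ≤ W y :=
    hconvex.add_deriv_mul_sub_le_of_hasDerivAt ⟨ha0, ha1⟩ hy hderiv
  have hone_le : W a + deriv W a * (1 - a) ≤ W 1 := by
    have hW : ContinuousAt W 1 := hC1.continuousOn.continuousAt (Ioi_mem_nhds one_pos)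
    have hline : ContinuousAt (fun y => W a + deriv W a * (y - a)) 1 := by fun_prop
    refine le_of_tendsto_of_tendsto (hline.mono_left (nhdsWithin_le_nhds (s := Iio 1)))
      (hW.mono_left nhdsWithin_le_nhds) ?_
    filter_upwards [Ioo_mem_nhdsLT (zero_lt_one' ℝ)] with y hy using htangent y hy
  have hslope : deriv W a ≤ 0 := by
    by_contra! h
    nlinarith [hnonneg a ha0, mul_pos h (sub_pos.2 ha1)]
  refine ⟨deriv W a, hslope, fun F hF => ?_⟩
  rcases lt_or_ge F 1 with h | h
  · exact htangent F ⟨hF, h⟩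
  · nlinarith [hnonneg F hF]

/-- An affine support of `W` with nonpositive slope induces one of the inverse energy
`H * W (1 / H)`. -/
theorem affine_support_inverse_energy {W Wstar : ℝ → ℝ} {a m h : ℝ}
    (hWstar : ∀ H : ℝ, 0 < H → Wstar H = H * W (1 / H)) (hWstar0 : Wstar 0 = 0)
    (hm : m ≤ 0) (hsupport : ∀ F, 0 < F → W a + m * (F - a) ≤ W F) (hh : 0 ≤ h) :
    (W a - m * a) * h + m ≤ Wstar h := by
  rcases hh.eq_or_lt with rfl | hh
  · simpa [hWstar0] using hm
  · rw [hWstar h hh]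
    calc (W a - m * a) * h + m = h * (W a + m * (1 / h - a)) := by field_simp; ring
      _ ≤ h * W (1 / h) := by gcongr; exact hsupport _ (by positivity)

/-- Proposition 1 (first part): for compressive loading `0 < λ ≤ 1`, the energy
`E_ε[H] = ∫₀^λ (ε²/2 (H')² + W*(H)) dy` of any admissible `H ∈ H¹(0,λ)`
(absolutely continuous with square-integrable derivative, `H ≥ 0` a.e.,
`∫₀^λ H = 1`) is at least `λ W*(1/λ)`, and the constant function `H ≡ 1/λ`
is admissible and attains this value. -/
theorem stmt_0
    (W Wstar : ℝ → ℝ) (lam ε : ℝ)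
    (hlam0 : 0 < lam) (hlam1 : lam ≤ 1) (hε : 0 < ε)
    (hW_C1 : ContDiffOn ℝ 1 W (Ioi 0))
    (hW_nonneg : ∀ F : ℝ, 0 < F → 0 ≤ W F)
    (hW_convex : ConvexOn ℝ (Ioo (0:ℝ) 1) W)
    (hW_one : W 1 = 0)
    (hWstar : ∀ H : ℝ, 0 < H → Wstar H = H * W (1 / H))
    (hWstar0 : Wstar 0 = 0)
    (H H' : ℝ → ℝ)
    (hH'_int : IntervalIntegrable H' volume 0 lam)
    (hH'_L2 : IntervalIntegrable (fun y => (H' y) ^ 2) volume 0 lam)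
    (hAC : ∀ y ∈ Icc (0:ℝ) lam, H y = H 0 + ∫ t in (0:ℝ)..y, H' t)
    (hH_nonneg : ∀ᵐ y ∂(volume.restrict (Ioo (0:ℝ) lam)), 0 ≤ H y)
    (hWsH_int : IntervalIntegrable (fun y => Wstar (H y)) volume 0 lam)
    (hcompat : (∫ y in (0:ℝ)..lam, H y) = 1) :
    lam * Wstar (1 / lam) ≤
        ∫ y in (0:ℝ)..lam, (ε ^ 2 / 2 * (H' y) ^ 2 + Wstar (H y)) ∧
    (∫ y in (0:ℝ)..lam, (1 / lam : ℝ)) = 1 ∧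
    (∫ y in (0:ℝ)..lam, (ε ^ 2 / 2 * (0 : ℝ) ^ 2 + Wstar (1 / lam))) =
        lam * Wstar (1 / lam) := by
  have hval : lam * Wstar (1 / lam) = W lam := by
    rw [hWstar _ (by positivity), one_div_one_div]
    field_simp
  refine ⟨?_, by simp [hlam0.ne'], by simp⟩
  obtain ⟨m, hm, hsupport⟩ :=
    exists_nonpos_slope_affine_support hlam0 hlam1 hW_C1 hW_nonneg hW_convex hW_one
  have hH_int : IntervalIntegrable H volume 0 lam :=
    intervalIntegrable_of_integral_ne_zero (by simp [hcompat])
  have hlin_int : IntervalIntegrable (fun y => (W lam - m * lam) * H y) volume 0 lam :=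
    hH_int.const_mul _
  have hconst_int : IntervalIntegrable (fun _ : ℝ => m) volume 0 lam := intervalIntegrable_const
  have hae : ∀ᵐ y ∂volume.restrict (Icc 0 lam), 0 ≤ H y := by
    rwa [← restrict_Ioo_eq_restrict_Icc]
  calc lam * Wstar (1 / lam) = ∫ y in (0 : ℝ)..lam, ((W lam - m * lam) * H y + m) := by
        rw [integral_add hlin_int hconst_int, intervalIntegral.integral_const_mul, hcompat,
          intervalIntegral.integral_const, hval, smul_eq_mul]
        ring
    _ ≤ ∫ y in (0 : ℝ)..lam, (ε ^ 2 / 2 * (H' y) ^ 2 + Wstar (H y)) := by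
        refine integral_mono_ae_restrict hlam0.le (hlin_int.add hconst_int)
          ((hH'_L2.const_mul _).add hWsH_int) ?_
        filter_upwards [hae] with y hy
        have hsq : 0 ≤ ε ^ 2 / 2 * (H' y) ^ 2 := by positivity
        linarith [affine_support_inverse_energy hWstar hWstar0 hm hsupport hy]
end

section
/- Let W : (0,∞) → [0,∞) be continuously differentiable, nonnegative, convex on (0,1), with W(1) = 0, and let W*(H) := H·W(1/H) for H > 0, extended by W*(0) := 0. Let 0 < λ ≤ 1, ε > 0 and k > 0. Then for every h ∈ H²(0,λ) (with h′′ ∈ L²) satisfying h′ ≥ 0 a.e., h(0) = 0 and h(λ) = 1, one has U_ε[h] := ∫₀^λ ( (ε²/2)(h′′(y))² + W*(h′(y)) + (k·h′(y)/2)(y − λ·h(y))² ) dy ≥ λ·W*(1/λ). Moreover the homogeneous inverse deformation h(y) = y/λ is admissible and attains this value, hence it minimizes U_ε over the admissible class. -/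
open MeasureTheory Set intervalIntegral

/-- A nonnegative function on `(0, ∞)` that vanishes at `1`, is differentiable and is convex on
`(0, 1)` has a nonincreasing affine minorant on `(0, ∞)` touching it at any given `a ∈ (0, 1]`. -/
theorem exists_nonpos_supporting_slope {W : ℝ → ℝ} {a : ℝ} (ha0 : 0 < a) (ha1 : a ≤ 1)
    (hdiff : DifferentiableOn ℝ W (Ioi 0)) (hnonneg : ∀ F : ℝ, 0 < F → 0 ≤ W F)
    (hconvex : ConvexOn ℝ (Ioo (0:ℝ) 1) W) (hone : W 1 = 0) :
    ∃ m ≤ (0:ℝ), ∀ F : ℝ, 0 < F → W a + m * (F - a) ≤ W F := by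
  rcases ha1.eq_or_lt with rfl | ha1
  · exact ⟨0, le_rfl, fun F hF => by simpa [hone] using hnonneg F hF⟩
  have hW : HasDerivAt W (deriv W a) a := (hdiff.differentiableAt (Ioi_mem_nhds ha0)).hasDerivAt
  have ha : a ∈ Ioo (0:ℝ) 1 := ⟨ha0, ha1⟩
  have hin : ∀ F ∈ Ioo (0:ℝ) 1, W a + deriv W a * (F - a) ≤ W F := by
    intro F hF
    rcases lt_trichotomy F a with hlt | rfl | hlt
    · have hs := hconvex.slope_le_of_hasDerivAt hF ha hlt hW
      rw [slope_def_field, div_le_iff₀ (by linarith)] at hs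
      linarith
    · simp
    · have hs := hconvex.le_slope_of_hasDerivAt ha hF hlt hW
      rw [slope_def_field, le_div_iff₀ (by linarith)] at hs
      linarith
  have hone' : W a + deriv W a * (1 - a) ≤ W 1 := by
    have hcW : Filter.Tendsto W (nhdsWithin 1 (Iio 1)) (nhds (W 1)) :=
      (hdiff.differentiableAt (Ioi_mem_nhds one_pos)).continuousAt.continuousWithinAt
    have hcL : Filter.Tendsto (fun F => W a + deriv W a * (F - a)) (nhdsWithin 1 (Iio 1))
        (nhds (W a + deriv W a * (1 - a))) :=
      (by fun_prop : Continuous fun F => W a + deriv W a * (F - a)).continuousWithinAt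
    refine le_of_tendsto_of_tendsto hcL hcW ?_
    filter_upwards [Ioo_mem_nhdsLT (zero_lt_one' ℝ)] with F hF using hin F hF
  have hWa := hnonneg a ha0
  have hm : deriv W a ≤ 0 := by
    by_contra! hpos
    nlinarith [mul_pos hpos (sub_pos.2 ha1)]
  refine ⟨deriv W a, hm, fun F hF => ?_⟩
  rcases lt_or_ge F 1 with hF1 | hF1
  · exact hin F ⟨hF, hF1⟩
  · nlinarith [hnonneg F hF, mul_nonneg (neg_nonneg.2 hm) (sub_nonneg.2 hF1)]

/-- Inversion turns an affine minorant of `W` into an affine minorant of `H ↦ H * W (1 / H)`. -/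
theorem affine_le_inverse_energy {W Wstar : ℝ → ℝ} {a m : ℝ} (hm : m ≤ 0)
    (hW : ∀ F : ℝ, 0 < F → W a + m * (F - a) ≤ W F)
    (hWstar : ∀ H : ℝ, 0 < H → Wstar H = H * W (1 / H)) (hWstar0 : Wstar 0 = 0)
    {H : ℝ} (hH : 0 ≤ H) : m + (W a - m * a) * H ≤ Wstar H := by
  rcases hH.eq_or_lt with rfl | hH
  · simpa [hWstar0] using hm
  · rw [hWstar H hH]
    have hmul := mul_le_mul_of_nonneg_left (hW (1 / H) (by positivity)) hH.le
    have heq : H * (W a + m * (1 / H - a)) = m + (W a - m * a) * H := by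
      field_simp
      ring
    linarith

/-- Proposition 1 (second part): for compressive loading `0 < λ ≤ 1`, the
foundation energy `U_ε[h] = ∫₀^λ (ε²/2 (h'')² + W*(h') + (k h'/2)(y-λh)²) dy`
of any admissible `h ∈ H²(0,λ)` (with `h' ≥ 0` a.e., `h(0)=0`, `h(λ)=1`) is at
least `λ W*(1/λ)`, and the homogeneous inverse deformation `h(y) = y/λ` is
admissible and attains this value. -/
theorem stmt_1
    (W Wstar : ℝ → ℝ) (lam ε k : ℝ)
    (hlam0 : 0 < lam) (hlam1 : lam ≤ 1) (hε : 0 < ε) (hk : 0 < k)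
    (hW_C1 : ContDiffOn ℝ 1 W (Ioi 0))
    (hW_nonneg : ∀ F : ℝ, 0 < F → 0 ≤ W F)
    (hW_convex : ConvexOn ℝ (Ioo (0:ℝ) 1) W)
    (hW_one : W 1 = 0)
    (hWstar : ∀ H : ℝ, 0 < H → Wstar H = H * W (1 / H))
    (hWstar0 : Wstar 0 = 0)
    (h h' h'' : ℝ → ℝ)
    (hAC1 : ∀ y ∈ Icc (0:ℝ) lam, h y = h 0 + ∫ t in (0:ℝ)..y, h' t)
    (hAC2 : ∀ y ∈ Icc (0:ℝ) lam, h' y = h' 0 + ∫ t in (0:ℝ)..y, h'' t)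
    (hh'_int : IntervalIntegrable h' volume 0 lam)
    (hh''_int : IntervalIntegrable h'' volume 0 lam)
    (hh''_L2 : IntervalIntegrable (fun y => (h'' y) ^ 2) volume 0 lam)
    (hWsh_int : IntervalIntegrable (fun y => Wstar (h' y)) volume 0 lam)
    (hfound_int : IntervalIntegrable
      (fun y => k * h' y / 2 * (y - lam * h y) ^ 2) volume 0 lam)
    (hh'_nonneg : ∀ᵐ y ∂(volume.restrict (Ioo (0:ℝ) lam)), 0 ≤ h' y)
    (hbc0 : h 0 = 0) (hbc1 : h lam = 1) :
    lam * Wstar (1 / lam) ≤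
        ∫ y in (0:ℝ)..lam,
          (ε ^ 2 / 2 * (h'' y) ^ 2 + Wstar (h' y) +
            k * h' y / 2 * (y - lam * h y) ^ 2) ∧
    (0 : ℝ) / lam = 0 ∧ lam / lam = 1 ∧
    (∫ y in (0:ℝ)..lam,
        (ε ^ 2 / 2 * (0 : ℝ) ^ 2 + Wstar (1 / lam) +
          k * (1 / lam) / 2 * (y - lam * (y / lam)) ^ 2)) =
      lam * Wstar (1 / lam) := by
  have hval : lam * Wstar (1 / lam) = W lam := by
    rw [hWstar _ (by positivity), one_div_one_div]
    field_simp
  refine ⟨?_, by simp, div_self hlam0.ne', ?_⟩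
  · obtain ⟨m, hm, hsupp⟩ := exists_nonpos_supporting_slope hlam0 hlam1
      (hW_C1.differentiableOn one_ne_zero) hW_nonneg hW_convex hW_one
    have hh' : ∫ t in (0:ℝ)..lam, h' t = 1 := by
      have hend := hAC1 lam ⟨hlam0.le, le_rfl⟩
      rw [hbc0, hbc1, zero_add] at hend
      exact hend.symm
    have haff : ∫ y in (0:ℝ)..lam, (m + (W lam - m * lam) * h' y) = lam * Wstar (1 / lam) := by
      rw [intervalIntegral.integral_add (by simp) (hh'_int.const_mul _),
        intervalIntegral.integral_const_mul, hh', hval, intervalIntegral.integral_const]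
      simp only [smul_eq_mul]
      ring
    rw [← haff]
    have hae : ∀ᵐ y ∂(volume.restrict (Icc (0:ℝ) lam)), 0 ≤ h' y := by
      rwa [← Measure.restrict_congr_set Ioo_ae_eq_Icc]
    refine intervalIntegral.integral_mono_ae_restrict hlam0.le
      (intervalIntegrable_const.add (hh'_int.const_mul _))
      (((hh''_L2.const_mul _).add hWsh_int).add hfound_int) ?_
    filter_upwards [hae] with y hy
    have hle := affine_le_inverse_energy hm hsupp hWstar hWstar0 hy
    have hbend : 0 ≤ ε ^ 2 / 2 * (h'' y) ^ 2 := by positivity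
    have hfound : 0 ≤ k * h' y / 2 * (y - lam * h y) ^ 2 := by positivity
    linarith
  · have hzero : ∀ y : ℝ, y - lam * (y / lam) = 0 := fun y => by
      field_simp
      ring
    simp [hzero]
end

section
/- Let λ ≥ 1. Let W* : [0,∞) → [0,∞) be continuous with W*(H) = 0 if and only if H ∈ {0,1}, and suppose there exist C > 0 and M > 1 with W*(H) ≥ C·H² for all H ≥ M. Set C_{W*} := ∫₀¹ √(2W*(τ)) dτ. Let H be a step function on (0,λ) taking values in {0,1} with exactly k jumps and with ∫₀^λ H dy = 1. Then for every sequence εₙ > 0 with εₙ → 0 there exists a recovery sequence Hₙ ∈ H¹(0,λ) with Hₙ ≥ 0 a.e. and ∫₀^λ Hₙ dy = 1, such that Hₙ → H in L¹(0,λ) and ∫₀^λ ( (εₙ/2)(Hₙ′)² + (1/εₙ)W*(Hₙ) ) dy → k·C_{W*}. -/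
open MeasureTheory Set Filter intervalIntegral

/-- `H` is (a.e. equal to) a step function on `(0,λ)` taking values in `{0,1}`
with exactly `k` jumps. -/
def IsStepOn (lam : ℝ) (H : ℝ → ℝ) (k : ℕ) : Prop :=
  ∃ (y : Fin (k + 2) → ℝ) (c : Fin (k + 1) → ℝ),
    StrictMono y ∧ y 0 = 0 ∧ y (Fin.last (k + 1)) = lam ∧
    (∀ i, c i = 0 ∨ c i = 1) ∧
    (∀ i : Fin k, c i.castSucc ≠ c i.succ) ∧
    (∀ i : Fin (k + 1),
      ∀ᵐ t ∂(volume.restrict (Ioo (y i.castSucc) (y i.succ))), H t = c i)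

/-- A global solution of an autonomous scalar equation with positive, bounded, continuous speed. -/
lemma exists_hasDerivAt_autonomous {F : ℝ → ℝ} {K : ℝ} (hF : Continuous F) (hpos : ∀ x, 0 < F x)
    (hK : ∀ x, F x ≤ K) :
    ∃ q : ℝ → ℝ, q 0 = 0 ∧ ∀ t, HasDerivAt q (F (q t)) t := by
  have hKpos : 0 < K := (hpos 0).trans_le (hK 0)
  have hinv : Continuous fun x => (F x)⁻¹ := hF.inv₀ fun x => (hpos x).ne'
  set T : ℝ → ℝ := fun x => ∫ u in (0 : ℝ)..x, (F u)⁻¹ with hT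
  have hderiv : ∀ x, HasDerivAt T (F x)⁻¹ x := fun x =>
    (hinv.integral_hasStrictDerivAt 0 x).hasDerivAt
  have hmono : StrictMono T := strictMono_of_hasDerivAt_pos hderiv fun x => inv_pos.2 (hpos x)
  have hcont : Continuous T := continuous_iff_continuousAt.2 fun x => (hderiv x).continuousAt
  have hT0 : T 0 = 0 := by simp [hT]
  have hslope : ∀ ⦃x y : ℝ⦄, x ≤ y → K⁻¹ * (y - x) ≤ T y - T x :=
    mul_sub_le_image_sub_of_le_deriv (fun x => (hderiv x).differentiableAt) fun x => by
      rw [(hderiv x).deriv]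
      exact inv_anti₀ (hpos x) (hK x)
  have hsurj : Function.Surjective T := by
    refine hcont.surjective ?_ ?_
    · refine tendsto_atTop_mono' atTop ?_
        (tendsto_id.const_mul_atTop (inv_pos.2 hKpos))
      filter_upwards [eventually_ge_atTop 0] with x hx
      simpa [hT0] using hslope hx
    · refine tendsto_atBot_mono' atBot ?_
        (tendsto_id.const_mul_atBot (inv_pos.2 hKpos))
      filter_upwards [eventually_le_atBot 0] with x hx
      have := hslope hx
      simp only [hT0, id] at this ⊢
      linarith
  set e := hmono.orderIsoOfSurjective T hsurj
  have hright : ∀ t, T (e.symm t) = t := fun t => e.apply_symm_apply t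
  refine ⟨e.symm, ?_, fun t => ?_⟩
  · exact hmono.injective ((hright 0).trans hT0.symm)
  · have := HasDerivAt.of_local_left_inverse (f := T) (g := e.symm) (a := t)
      e.symm.continuous.continuousAt (hderiv (e.symm t)) (inv_pos.2 (hpos _)).ne'
      (Eventually.of_forall hright)
    simpa using this

lemma sqrt_two_mul_le_half_add_div {W δ : ℝ} (hW : 0 ≤ W) (hδ : 0 < δ) :
    √(2 * W) ≤ √(δ + 2 * W) / 2 + W / √(δ + 2 * W) := by
  have hR : 0 < √(δ + 2 * W) := Real.sqrt_pos.2 (by linarith)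
  have h2 : √(2 * W) ^ 2 = 2 * W := Real.sq_sqrt (by linarith)
  have hW' : W = √(2 * W) ^ 2 / 2 := by linarith
  rw [div_add_div _ _ two_ne_zero hR.ne', le_div_iff₀ (by positivity)]
  nlinarith [sq_nonneg (√(2 * W) - √(δ + 2 * W))]

lemma half_add_div_le_sqrt_add {W δ : ℝ} (hW : 0 ≤ W) (hδ : 0 < δ) :
    √(δ + 2 * W) / 2 + W / √(δ + 2 * W) ≤ √δ + √(2 * W) := by
  have hR : 0 < √(δ + 2 * W) := Real.sqrt_pos.2 (by linarith)
  have h2 : √(δ + 2 * W) ^ 2 = δ + 2 * W := Real.sq_sqrt (by linarith)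
  have hle : √(δ + 2 * W) ≤ √δ + √(2 * W) := by
    refine Real.sqrt_le_iff.2 ⟨by positivity, ?_⟩
    nlinarith [Real.sq_sqrt hδ.le, Real.sq_sqrt (show 0 ≤ 2 * W by linarith),
      mul_nonneg (Real.sqrt_nonneg δ) (Real.sqrt_nonneg (2 * W))]
  refine le_trans ?_ hle
  rw [div_add_div _ _ two_ne_zero hR.ne', div_le_iff₀ (by positivity)]
  nlinarith

/-- An optimal-profile transition from `0` to `1` for the potential `W + δ / 2`. -/
lemma exists_transition_up {W : ℝ → ℝ} (hcont : ContinuousOn W (Ici 0))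
    (hnonneg : ∀ x, 0 ≤ x → 0 ≤ W x) {ε δ : ℝ} (hε : 0 < ε) (hδ : 0 < δ) :
    ∃ (η : ℝ) (f g : ℝ → ℝ), 0 ≤ η ∧ η ≤ ε / √δ ∧ Continuous g ∧ (∀ t, HasDerivAt f (g t) t) ∧
      f 0 = 0 ∧ f η = 1 ∧ (∀ t ∈ Icc 0 η, f t ∈ Icc (0 : ℝ) 1) ∧
      |(∫ t in (0 : ℝ)..η, (ε / 2 * g t ^ 2 + 1 / ε * W (f t))) - ∫ τ in (0 : ℝ)..1, √(2 * W τ)|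
        ≤ √δ := by
  set V : ℝ → ℝ := fun x => W (projIcc 0 1 zero_le_one x) with hV
  have hVc : Continuous V := by
    refine hcont.comp_continuous (continuous_subtype_val.comp continuous_projIcc) fun x => ?_
    exact (projIcc (0 : ℝ) 1 zero_le_one x).2.1
  have hVW : ∀ x ∈ Icc (0 : ℝ) 1, V x = W x := fun x hx => by
    simp only [hV, projIcc_of_mem zero_le_one hx]
  have hV0 : ∀ x, 0 ≤ V x := fun x => hnonneg _ (projIcc (0 : ℝ) 1 zero_le_one x).2.1
  obtain ⟨B, hB⟩ : ∃ B, ∀ x, V x ≤ B := by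
    obtain ⟨B, hB⟩ := (isCompact_Icc (a := (0 : ℝ)) (b := 1)).bddAbove_image
      (hcont.mono Icc_subset_Ici_self)
    exact ⟨B, fun x => hB ⟨_, (projIcc (0 : ℝ) 1 zero_le_one x).2, rfl⟩⟩
  set R : ℝ → ℝ := fun x => √(δ + 2 * V x) with hR
  have hRc : Continuous R := by fun_prop
  have hRδ : ∀ x, √δ ≤ R x := fun x => Real.sqrt_le_sqrt (by linarith [hV0 x])
  have hδ' : 0 < √δ := Real.sqrt_pos.2 hδ
  have hRpos : ∀ x, 0 < R x := fun x => hδ'.trans_le (hRδ x)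
  obtain ⟨f, hf0, hf⟩ := exists_hasDerivAt_autonomous (F := fun x => R x / ε)
    (K := √(δ + 2 * B) / ε) (by fun_prop) (fun x => div_pos (hRpos x) hε)
    (fun x => by
      have := hB x
      simp only [hR]
      gcongr)
  have hfc : Continuous f := continuous_iff_continuousAt.2 fun t => (hf t).continuousAt
  have hfm : StrictMono f := strictMono_of_hasDerivAt_pos hf fun t => div_pos (hRpos _) hε
  have hslope : ∀ ⦃x y : ℝ⦄, x ≤ y → √δ / ε * (y - x) ≤ f y - f x :=
    mul_sub_le_image_sub_of_le_deriv (fun x => (hf x).differentiableAt) fun x => by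
      rw [(hf x).deriv]
      gcongr
      exact hRδ _
  have hlen : 0 ≤ ε / √δ := by positivity
  obtain ⟨η, hη, hfη⟩ : ∃ η ∈ Icc 0 (ε / √δ), f η = 1 := by
    refine intermediate_value_Icc hlen hfc.continuousOn ⟨by rw [hf0]; exact zero_le_one, ?_⟩
    have := hslope hlen
    rw [hf0, sub_zero, sub_zero, div_mul_div_cancel₀ hε.ne', div_self hδ'.ne'] at this
    exact this
  have hfmem : ∀ t ∈ Icc 0 η, f t ∈ Icc (0 : ℝ) 1 := fun t ht =>
    ⟨hf0 ▸ hfm.monotone ht.1, hfη ▸ hfm.monotone ht.2⟩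
  refine ⟨η, f, fun t => R (f t) / ε, hη.1, hη.2, by fun_prop, hf, hf0, hfη, hfmem, ?_⟩
  set h : ℝ → ℝ := fun x => R x / 2 + V x / R x with hh
  have hhc : Continuous h := by
    have := hVc.div hRc fun x => (hRpos x).ne'
    exact (hRc.div_const 2).add this
  have henergy : (∫ t in (0 : ℝ)..η, (ε / 2 * (R (f t) / ε) ^ 2 + 1 / ε * W (f t)))
      = ∫ τ in (0 : ℝ)..1, h τ := by
    have hsubst := integral_comp_mul_deriv (a := 0) (b := η) (fun x _ => hf x) (by fun_prop) hhc
    rw [hf0, hfη] at hsubst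
    rw [← hsubst]
    refine integral_congr fun t ht => ?_
    rw [uIcc_of_le hη.1] at ht
    have := (hRpos (f t)).ne'
    simp only [Function.comp_apply, hh, ← hVW _ (hfmem t ht)]
    field_simp
  have hsqrt : (∫ τ in (0 : ℝ)..1, √(2 * W τ)) = ∫ τ in (0 : ℝ)..1, √(2 * V τ) := by
    refine integral_congr fun t ht => ?_
    rw [uIcc_of_le zero_le_one] at ht
    simp only [hVW t ht]
  have hsc : Continuous fun τ => √(2 * V τ) := by fun_prop
  have hlow : (∫ τ in (0 : ℝ)..1, √(2 * V τ)) ≤ ∫ τ in (0 : ℝ)..1, h τ :=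
    integral_mono_on zero_le_one (hsc.intervalIntegrable _ _) (hhc.intervalIntegrable _ _)
      fun x _ => sqrt_two_mul_le_half_add_div (hV0 x) hδ
  have hup : (∫ τ in (0 : ℝ)..1, h τ) ≤ ∫ τ in (0 : ℝ)..1, (√δ + √(2 * V τ)) :=
    integral_mono_on zero_le_one (hhc.intervalIntegrable _ _)
      ((continuous_const.add hsc).intervalIntegrable _ _)
      fun x _ => half_add_div_le_sqrt_add (hV0 x) hδ
  rw [integral_add (by simp) (hsc.intervalIntegrable _ _), intervalIntegral.integral_const] at hup
  simp only [sub_zero, one_smul] at hup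
  beta_reduce
  rw [henergy, hsqrt, abs_le]
  constructor <;> linarith

/-- A transition between the two wells `p ≠ q`, in either direction. -/
lemma exists_transition {W : ℝ → ℝ} (hcont : ContinuousOn W (Ici 0))
    (hnonneg : ∀ x, 0 ≤ x → 0 ≤ W x) {ε δ : ℝ} (hε : 0 < ε) (hδ : 0 < δ) {p q : ℝ}
    (hp : p = 0 ∨ p = 1) (hq : q = 0 ∨ q = 1) (hpq : p ≠ q) :
    ∃ (η : ℝ) (f g : ℝ → ℝ), 0 ≤ η ∧ η ≤ ε / √δ ∧ Continuous g ∧ (∀ t, HasDerivAt f (g t) t) ∧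
      f 0 = p ∧ f η = q ∧ (∀ t ∈ Icc 0 η, f t ∈ Icc (0 : ℝ) 1) ∧
      |(∫ t in (0 : ℝ)..η, (ε / 2 * g t ^ 2 + 1 / ε * W (f t))) - ∫ τ in (0 : ℝ)..1, √(2 * W τ)|
        ≤ √δ := by
  obtain ⟨η, f, g, hη0, hη, hg, hf, hf0, hfη, hmem, hE⟩ :=
    exists_transition_up hcont hnonneg hε hδ
  rcases hp with rfl | rfl <;> rcases hq with rfl | rfl
  · exact absurd rfl hpq
  · exact ⟨η, f, g, hη0, hη, hg, hf, hf0, hfη, hmem, hE⟩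
  · refine ⟨η, fun t => f (η - t), fun t => -g (η - t), hη0, hη, by fun_prop, fun t => ?_,
      by simpa using hfη, by simpa using hf0, fun t ht => hmem _ ⟨?_, ?_⟩, ?_⟩
    · simpa using (hf (η - t)).comp_const_sub η t
    · linarith [ht.2]
    · linarith [ht.1]
    · have := intervalIntegral.integral_comp_sub_left (a := 0) (b := η)
        (fun t => ε / 2 * g t ^ 2 + 1 / ε * W (f t)) η
      simp only [sub_self, sub_zero] at this
      simpa only [neg_sq, this] using hE
  · exact absurd rfl hpq

/-- There is a nonnegative `H¹` function on `[a, b]` running from `p` to `q` whose excess mass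
over `H`, whose `L¹` distance to `H` and whose energy are `m`, `L` and `E`. -/
def HasCompetitor (W : ℝ → ℝ) (ε : ℝ) (H : ℝ → ℝ) (a b p q m L E : ℝ) : Prop :=
  ∃ f g : ℝ → ℝ, f a = p ∧ f b = q ∧
    (∀ t ∈ Icc a b, f t = p + ∫ s in a..t, g s) ∧
    IntervalIntegrable g volume a b ∧
    IntervalIntegrable (fun t => g t ^ 2) volume a b ∧
    IntervalIntegrable (fun t => W (f t)) volume a b ∧
    (∀ t ∈ Icc a b, 0 ≤ f t) ∧
    IntervalIntegrable (fun t => f t - H t) volume a b ∧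
    (∫ t in a..b, (f t - H t)) = m ∧
    (∫ t in a..b, |f t - H t|) = L ∧
    (∫ t in a..b, (ε / 2 * g t ^ 2 + 1 / ε * W (f t))) = E

lemma IntervalIntegrable.glue {F F₁ F₂ : ℝ → ℝ} {a c b : ℝ} (hac : a ≤ c) (hcb : c ≤ b)
    (h₁ : EqOn F₁ F (Ioc a c)) (h₂ : EqOn F₂ F (Ioc c b))
    (hF₁ : IntervalIntegrable F₁ volume a c) (hF₂ : IntervalIntegrable F₂ volume c b) :
    IntervalIntegrable F volume a b ∧
      (∫ t in a..b, F t) = (∫ t in a..c, F₁ t) + ∫ t in c..b, F₂ t := by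
  rw [← uIoc_of_le hac] at h₁
  rw [← uIoc_of_le hcb] at h₂
  have hF₁' := hF₁.congr h₁
  have hF₂' := hF₂.congr h₂
  refine ⟨hF₁'.trans hF₂', ?_⟩
  rw [← integral_add_adjacent_intervals hF₁' hF₂',
    intervalIntegral.integral_congr_ae (Eventually.of_forall fun t ht => h₁ ht),
    intervalIntegral.integral_congr_ae (Eventually.of_forall fun t ht => h₂ ht)]

lemma HasCompetitor.glue {W H : ℝ → ℝ} {ε a c b p q r m m' L L' E E' : ℝ}
    (hac : a ≤ c) (hcb : c ≤ b) (h : HasCompetitor W ε H a c p q m L E)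
    (h' : HasCompetitor W ε H c b q r m' L' E') :
    HasCompetitor W ε H a b p r (m + m') (L + L') (E + E') := by
  obtain ⟨f, g, hfa, hfc, hf, hg, hg2, hW, hf0, hfH, rfl, rfl, rfl⟩ := h
  obtain ⟨f', g', hfc', hfb', hf', hg', hg2', hW', hf0', hfH', rfl, rfl, rfl⟩ := h'
  set u : ℝ → ℝ := fun t => if t ≤ c then f t else f' t with hu
  set v : ℝ → ℝ := fun t => if t ≤ c then g t else g' t with hv
  have hu₁ : ∀ t, t ≤ c → u t = f t := fun t ht => if_pos ht
  have hu₂ : ∀ t, c < t → u t = f' t := fun t ht => if_neg ht.not_ge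
  have hv₁ : ∀ t, t ≤ c → v t = g t := fun t ht => if_pos ht
  have hv₂ : ∀ t, c < t → v t = g' t := fun t ht => if_neg ht.not_ge
  have hcomp : ∀ Φ : ℝ → ℝ → ℝ → ℝ,
      IntervalIntegrable (fun t => Φ t (f t) (g t)) volume a c →
      IntervalIntegrable (fun t => Φ t (f' t) (g' t)) volume c b →
      IntervalIntegrable (fun t => Φ t (u t) (v t)) volume a b ∧
        (∫ t in a..b, Φ t (u t) (v t)) =
          (∫ t in a..c, Φ t (f t) (g t)) + ∫ t in c..b, Φ t (f' t) (g' t) :=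
    fun Φ h₁ h₂ => IntervalIntegrable.glue hac hcb
      (fun t ht => by simp only [hu₁ t ht.2, hv₁ t ht.2])
      (fun t ht => by simp only [hu₂ t ht.1, hv₂ t ht.1]) h₁ h₂
  have hub : u b = r := by
    rcases hcb.eq_or_lt with rfl | hlt
    · rw [hu₁ _ le_rfl, hfc, ← hfc', hfb']
    · rw [hu₂ _ hlt, hfb']
  refine ⟨u, v, by rw [hu₁ _ hac, hfa], hub, fun t ht => ?_,
    (hcomp (fun _ _ z => z) hg hg').1, (hcomp (fun _ _ z => z ^ 2) hg2 hg2').1,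
    (hcomp (fun _ x _ => W x) hW hW').1, fun t ht => ?_,
    (hcomp (fun t x _ => x - H t) hfH hfH').1, (hcomp (fun t x _ => x - H t) hfH hfH').2,
    (hcomp (fun t x _ => |x - H t|) hfH.abs hfH'.abs).2,
    (hcomp (fun _ x z => ε / 2 * z ^ 2 + 1 / ε * W x)
      ((hg2.const_mul _).add (hW.const_mul _)) ((hg2'.const_mul _).add (hW'.const_mul _))).2⟩
  · rcases le_or_gt t c with htc | htc
    · rw [hu₁ t htc, hf t ⟨ht.1, htc⟩]
      congr 1
      refine integral_congr fun s hs => ?_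
      rw [uIcc_of_le ht.1] at hs
      exact (hv₁ s (hs.2.trans htc)).symm
    · have hg't : IntervalIntegrable g' volume c t := by
        refine hg'.mono_set ?_
        rw [uIcc_of_le htc.le, uIcc_of_le hcb]
        exact Icc_subset_Icc_right ht.2
      rw [hu₂ t htc, hf' t ⟨htc.le, ht.2⟩, ← hfc, hf c ⟨hac, le_rfl⟩, add_assoc,
        (IntervalIntegrable.glue (F := v) hac htc.le (fun s hs => (hv₁ s hs.2).symm)
          (fun s hs => (hv₂ s hs.1).symm) hg hg't).2]
  · rcases le_or_gt t c with htc | htc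
    · rw [hu₁ t htc]
      exact hf0 t ⟨ht.1, htc⟩
    · rw [hu₂ t htc]
      exact hf0' t ⟨htc.le, ht.2⟩

lemma HasCompetitor.of_hasDerivAt {W H f g : ℝ → ℝ} (hcont : ContinuousOn W (Ici 0))
    {a b : ℝ} (hab : a ≤ b) (hf : ∀ t, HasDerivAt f (g t) t) (hg : Continuous g)
    (hf0 : ∀ t ∈ Icc a b, 0 ≤ f t) (hH : IntervalIntegrable H volume a b) (ε : ℝ) :
    HasCompetitor W ε H a b (f a) (f b) (∫ t in a..b, (f t - H t)) (∫ t in a..b, |f t - H t|)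
      (∫ t in a..b, (ε / 2 * g t ^ 2 + 1 / ε * W (f t))) := by
  have hfc : Continuous f := continuous_iff_continuousAt.2 fun t => (hf t).continuousAt
  refine ⟨f, g, rfl, rfl, fun t _ => ?_, hg.intervalIntegrable _ _,
    (hg.pow 2).intervalIntegrable _ _, ContinuousOn.intervalIntegrable ?_, hf0,
    (hfc.intervalIntegrable _ _).sub hH, rfl, rfl, rfl⟩
  · rw [integral_eq_sub_of_hasDerivAt (fun s _ => hf s) (hg.intervalIntegrable _ _)]
    ring
  · rw [uIcc_of_le hab]
    exact hcont.comp hfc.continuousOn hf0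

lemma intervalIntegrable_and_integral_of_ae_eq_const {H : ℝ → ℝ} {a b c : ℝ} (hab : a ≤ b)
    (h : ∀ᵐ t, t ∈ Ioo a b → H t = c) :
    IntervalIntegrable H volume a b ∧ (∫ t in a..b, H t) = (b - a) * c := by
  have h' : H =ᵐ[volume.restrict (uIoc a b)] fun _ => c := by
    rw [uIoc_of_le hab, ← restrict_Ioo_eq_restrict_Ioc]
    exact (ae_restrict_iff' measurableSet_Ioo).2 h
  refine ⟨intervalIntegrable_const.congr_ae h'.symm, ?_⟩
  rw [intervalIntegral.integral_congr_ae_restrict h', intervalIntegral.integral_const, smul_eq_mul]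

lemma HasCompetitor.const {W H : ℝ → ℝ} (hcont : ContinuousOn W (Ici 0)) {a b c : ℝ}
    (hab : a ≤ b) (hc : 0 ≤ c) (hWc : W c = 0) (h : ∀ᵐ t, t ∈ Ioo a b → H t = c) (ε : ℝ) :
    HasCompetitor W ε H a b c c 0 0 0 := by
  have key := HasCompetitor.of_hasDerivAt hcont hab (fun t => hasDerivAt_const t c)
    continuous_const (fun _ _ => hc) (intervalIntegrable_and_integral_of_ae_eq_const hab h).1 ε
  have h0 : ∀ᵐ t, t ∈ Ioo a b → c - H t = 0 := h.mono fun t ht hmem => by rw [ht hmem, sub_self]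
  have h1 : ∀ᵐ t, t ∈ Ioo a b → |c - H t| = 0 := h0.mono fun t ht hmem => by
    rw [ht hmem, abs_zero]
  simpa [hWc, (intervalIntegrable_and_integral_of_ae_eq_const hab h0).2,
    (intervalIntegrable_and_integral_of_ae_eq_const hab h1).2] using key

/-- A jump of `H` from `p` to `q` at `y` can be replaced by a mass-preserving transition. -/
lemma HasCompetitor.exists_jump {W H : ℝ → ℝ} (hcont : ContinuousOn W (Ici 0))
    (hnonneg : ∀ x, 0 ≤ x → 0 ≤ W x) (hW0 : W 0 = 0) (hW1 : W 1 = 0) {ε δ : ℝ} (hε : 0 < ε)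
    (hδ : 0 < δ) {a y b p q : ℝ} (hp : p = 0 ∨ p = 1) (hq : q = 0 ∨ q = 1) (hpq : p ≠ q)
    (hay : ε / √δ ≤ y - a) (hyb : ε / √δ ≤ b - y)
    (hHp : ∀ᵐ t, t ∈ Ioo a y → H t = p) (hHq : ∀ᵐ t, t ∈ Ioo y b → H t = q) :
    ∃ L E, HasCompetitor W ε H a b p q 0 L E ∧ |L| ≤ ε / √δ ∧
      |E - ∫ τ in (0 : ℝ)..1, √(2 * W τ)| ≤ √δ := by
  obtain ⟨η, f, g, hη0, hη, hg, hf, hf0, hfη, hmem, hE⟩ :=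
    exists_transition hcont hnonneg hε hδ hp hq hpq
  have hfc : Continuous f := continuous_iff_continuousAt.2 fun t => (hf t).continuousAt
  have hint0 : 0 ≤ ∫ t in (0 : ℝ)..η, f t :=
    intervalIntegral.integral_nonneg hη0 fun t ht => (hmem t ht).1
  have hint1 : (∫ t in (0 : ℝ)..η, f t) ≤ η := by
    simpa using integral_mono_on (μ := volume) hη0 (hfc.intervalIntegrable _ _)
      (intervalIntegrable_const (c := (1 : ℝ))) fun t ht => (hmem t ht).2
  obtain ⟨s, hs0, hsη, hs⟩ : ∃ s, 0 ≤ s ∧ s ≤ η ∧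
      s * p + (η - s) * q = ∫ t in (0 : ℝ)..η, f t := by
    rcases hp with rfl | rfl <;> rcases hq with rfl | rfl
    · exact absurd rfl hpq
    · exact ⟨η - ∫ t in (0 : ℝ)..η, f t, by linarith, by linarith, by ring⟩
    · exact ⟨∫ t in (0 : ℝ)..η, f t, by linarith, by linarith, by ring⟩
    · exact absurd rfl hpq
  have hWpq : ∀ x : ℝ, x = 0 ∨ x = 1 → 0 ≤ x ∧ W x = 0 := by
    rintro x (rfl | rfl)
    exacts [⟨le_rfl, hW0⟩, ⟨zero_le_one, hW1⟩]
  set z := y - s with hz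
  have haz : a ≤ z := by linarith
  have hzη : z + η ≤ b := by linarith
  have hleft : HasCompetitor W ε H a z p p 0 0 0 :=
    HasCompetitor.const hcont haz (hWpq p hp).1 (hWpq p hp).2
      (hHp.mono fun t ht hm => ht ⟨hm.1, by linarith [hm.2]⟩) ε
  have hright : HasCompetitor W ε H (z + η) b q q 0 0 0 :=
    HasCompetitor.const hcont hzη (hWpq q hq).1 (hWpq q hq).2
      (hHq.mono fun t ht hm => ht ⟨by linarith [hm.1], hm.2⟩) ε
  obtain ⟨hIp, hJp⟩ := intervalIntegrable_and_integral_of_ae_eq_const (H := H) (a := z) (b := y)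
    (c := p) (by linarith) (hHp.mono fun t ht hm => ht ⟨by linarith [hm.1], hm.2⟩)
  obtain ⟨hIq, hJq⟩ := intervalIntegrable_and_integral_of_ae_eq_const (H := H) (a := y)
    (b := z + η) (c := q) (by linarith)
    (hHq.mono fun t ht hm => ht ⟨hm.1, by linarith [hm.2]⟩)
  have hmid := HasCompetitor.of_hasDerivAt (H := H) hcont (a := z) (b := z + η) (by linarith)
    (f := fun t => f (t - z)) (g := fun t => g (t - z))
    (fun t => by simpa using (hf (t - z)).comp_sub_const t z) (by fun_prop)
    (fun t ht => (hmem _ ⟨by linarith [ht.1], by linarith [ht.2]⟩).1) (hIp.trans hIq) ε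
  have hmass : (∫ t in z..z + η, (f (t - z) - H t)) = 0 := by
    have hfz : Continuous fun t => f (t - z) := by fun_prop
    rw [integral_sub (hfz.intervalIntegrable _ _) (hIp.trans hIq),
      ← integral_add_adjacent_intervals hIp hIq, hJp, hJq,
      intervalIntegral.integral_comp_sub_right f z, sub_self, add_sub_cancel_left, ← hs]
    ring
  have henergy : (∫ t in z..z + η, (ε / 2 * g (t - z) ^ 2 + 1 / ε * W (f (t - z)))) =
      ∫ t in (0 : ℝ)..η, (ε / 2 * g t ^ 2 + 1 / ε * W (f t)) := by
    rw [intervalIntegral.integral_comp_sub_right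
      (fun t => ε / 2 * g t ^ 2 + 1 / ε * W (f t)) z, sub_self, add_sub_cancel_left]
  have hL1 : |(∫ t in z..z + η, |f (t - z) - H t|)| ≤ η := by
    have hbound : ∀ᵐ t, t ∈ uIoc z (z + η) → ‖|f (t - z) - H t|‖ ≤ 1 := by
      filter_upwards [hHp, hHq, Measure.ae_ne volume y, Measure.ae_ne volume b]
        with t h₁ h₂ hy hb ht
      rw [uIoc_of_le (by linarith)] at ht
      have hft := hmem (t - z) ⟨by linarith [ht.1], by linarith [ht.2]⟩
      have hHt : H t = 0 ∨ H t = 1 := by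
        rcases hy.lt_or_gt with hlt | hgt
        · rw [h₁ ⟨by linarith [ht.1], hlt⟩]
          exact hp
        · rw [h₂ ⟨hgt, lt_of_le_of_ne (by linarith [ht.2]) hb⟩]
          exact hq
      rw [Real.norm_eq_abs, abs_abs, abs_le]
      rcases hHt with hHt | hHt <;> rw [hHt] <;> constructor <;> linarith [hft.1, hft.2]
    have := norm_integral_le_of_norm_le_const_ae hbound
    rwa [Real.norm_eq_abs, add_sub_cancel_left, one_mul, abs_of_nonneg hη0] at this
  simp only [sub_self, hf0, add_sub_cancel_left, hfη, hmass, henergy] at hmid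
  refine ⟨_, _, by simpa using (hleft.glue haz (by linarith) hmid).glue (by linarith) hzη hright,
    by simpa using hL1.trans hη, by simpa using hE⟩

/-- `H` admits mass-preserving competitors on `[a, b]`, with boundary values `p` and `q`,
converging to `H` in `L¹` and with energies converging to `κ`. -/
def HasRecovery (W : ℝ → ℝ) (eps : ℕ → ℝ) (H : ℝ → ℝ) (a b p q κ : ℝ) : Prop :=
  ∃ L E : ℕ → ℝ, (∀ n, HasCompetitor W (eps n) H a b p q 0 (L n) (E n)) ∧
    Tendsto L atTop (nhds 0) ∧ Tendsto E atTop (nhds κ)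

lemma HasRecovery.glue {W H : ℝ → ℝ} {eps : ℕ → ℝ} {a c b p q r κ κ' : ℝ}
    (hac : a ≤ c) (hcb : c ≤ b) (h : HasRecovery W eps H a c p q κ)
    (h' : HasRecovery W eps H c b q r κ') : HasRecovery W eps H a b p r (κ + κ') := by
  obtain ⟨L, E, hC, hL, hE⟩ := h
  obtain ⟨L', E', hC', hL', hE'⟩ := h'
  exact ⟨fun n => L n + L' n, fun n => E n + E' n,
    fun n => by simpa using (hC n).glue hac hcb (hC' n), by simpa using hL.add hL', hE.add hE'⟩

lemma HasRecovery.const {W H : ℝ → ℝ} (hcont : ContinuousOn W (Ici 0)) {a b c : ℝ}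
    (hab : a ≤ b) (hc : 0 ≤ c) (hWc : W c = 0) (h : ∀ᵐ t, t ∈ Ioo a b → H t = c)
    (eps : ℕ → ℝ) : HasRecovery W eps H a b c c 0 :=
  ⟨fun _ => 0, fun _ => 0, fun n => HasCompetitor.const hcont hab hc hWc h (eps n),
    tendsto_const_nhds, tendsto_const_nhds⟩

lemma HasRecovery.jump {W H : ℝ → ℝ} (hcont : ContinuousOn W (Ici 0))
    (hnonneg : ∀ x, 0 ≤ x → 0 ≤ W x) (hW0 : W 0 = 0) (hW1 : W 1 = 0) {eps : ℕ → ℝ}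
    (heps : ∀ n, 0 < eps n) (heps0 : Tendsto eps atTop (nhds 0)) {a y b p q : ℝ}
    (hay : a < y) (hyb : y < b) (hp : p = 0 ∨ p = 1) (hq : q = 0 ∨ q = 1) (hpq : p ≠ q)
    (hHp : ∀ᵐ t, t ∈ Ioo a y → H t = p) (hHq : ∀ᵐ t, t ∈ Ioo y b → H t = q) :
    HasRecovery W eps H a b p q (∫ τ in (0 : ℝ)..1, √(2 * W τ)) := by
  obtain ⟨d, hd, hda, hdb⟩ : ∃ d > 0, d ≤ y - a ∧ d ≤ b - y :=
    ⟨min (y - a) (b - y), lt_min (by linarith) (by linarith), min_le_left _ _, min_le_right _ _⟩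
  set δ : ℕ → ℝ := fun n => eps n + (eps n / d) ^ 2 with hδ
  have hδpos : ∀ n, 0 < δ n := fun n => add_pos_of_pos_of_nonneg (heps n) (sq_nonneg _)
  have hδ0 : Tendsto (fun n => √(δ n)) atTop (nhds 0) := by
    have : Tendsto δ atTop (nhds (0 + (0 / d) ^ 2)) := heps0.add ((heps0.div_const d).pow 2)
    simpa using this.sqrt
  have hsqrt0 : Tendsto (fun n => √(eps n)) atTop (nhds 0) := by simpa using heps0.sqrt
  have hd_le : ∀ n, eps n / √(δ n) ≤ d := fun n => by
    rw [div_le_comm₀ (Real.sqrt_pos.2 (hδpos n)) hd]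
    exact Real.le_sqrt_of_sq_le (le_add_of_nonneg_left (heps n).le)
  have hlen : ∀ n, eps n / √(δ n) ≤ √(eps n) := fun n => by
    rw [div_le_iff₀ (Real.sqrt_pos.2 (hδpos n)), ← Real.sqrt_mul (heps n).le]
    refine Real.le_sqrt_of_sq_le ?_
    rw [sq]
    exact mul_le_mul_of_nonneg_left (le_add_of_nonneg_right (sq_nonneg _)) (heps n).le
  choose L E hC hL hE using fun n => HasCompetitor.exists_jump hcont hnonneg hW0 hW1 (heps n)
    (hδpos n) hp hq hpq ((hd_le n).trans hda) ((hd_le n).trans hdb) hHp hHq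
  refine ⟨L, E, hC, squeeze_zero_norm (fun n => (hL n).trans (hlen n)) hsqrt0, ?_⟩
  exact tendsto_iff_norm_sub_tendsto_zero.2 (squeeze_zero (fun _ => norm_nonneg _) hE hδ0)

lemma HasRecovery.of_isStepOn {W H : ℝ → ℝ} (hcont : ContinuousOn W (Ici 0))
    (hnonneg : ∀ x, 0 ≤ x → 0 ≤ W x) (hW0 : W 0 = 0) (hW1 : W 1 = 0) {eps : ℕ → ℝ}
    (heps : ∀ n, 0 < eps n) (heps0 : Tendsto eps atTop (nhds 0)) {lam : ℝ} {k : ℕ}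
    (hstep : IsStepOn lam H k) :
    ∃ p q, HasRecovery W eps H 0 lam p q (k * ∫ τ in (0 : ℝ)..1, √(2 * W τ)) := by
  obtain ⟨y, c, hy, hy0, hylam, hc, hjump, hH⟩ := hstep
  have hwell : ∀ i, 0 ≤ c i ∧ W (c i) = 0 := fun i => by
    rcases hc i with h | h <;> rw [h]
    exacts [⟨le_rfl, hW0⟩, ⟨zero_le_one, hW1⟩]
  have hlt : ∀ i : Fin (k + 1), y i.castSucc < y i.succ := fun i => hy i.castSucc_lt_succ
  have hnn : ∀ i, 0 ≤ y i := fun i => hy0 ▸ hy.monotone (Fin.zero_le i)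
  have hsub : ∀ i (a b : ℝ), y i.castSucc ≤ a → b ≤ y i.succ →
      ∀ᵐ t, t ∈ Ioo a b → H t = c i := fun i a b ha hb =>
    ((ae_restrict_iff' measurableSet_Ioo).1 (hH i)).mono fun t ht hm =>
      ht ⟨ha.trans_lt hm.1, hm.2.trans_le hb⟩
  have hmid : ∀ i : Fin (k + 1), HasRecovery W eps H 0 ((y i.castSucc + y i.succ) / 2) (c 0) (c i)
      ((i : ℕ) * ∫ τ in (0 : ℝ)..1, √(2 * W τ)) := by
    intro i
    induction i using Fin.induction with
    | zero =>
      have := hlt 0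
      have h0 : y (Fin.castSucc 0) = 0 := hy0
      simpa using HasRecovery.const hcont
        (by linarith) (hwell 0).1 (hwell 0).2
        (hsub 0 0 ((y (Fin.castSucc 0) + y (Fin.succ 0)) / 2) h0.le (by linarith)) eps
    | succ i ih =>
      have h₁ := hlt i.castSucc
      have h₂ := hlt i.succ
      have h₃ := hnn i.castSucc.castSucc
      rw [Fin.succ_castSucc] at h₁ ih
      have hs := HasRecovery.jump hcont hnonneg hW0 hW1 heps heps0
        (a := (y i.castSucc.castSucc + y i.succ.castSucc) / 2) (y := y i.succ.castSucc)
        (b := (y i.succ.castSucc + y i.succ.succ) / 2) (by linarith) (by linarith)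
        (hc i.castSucc) (hc i.succ) (hjump i)
        (hsub i.castSucc _ _ (by linarith) (by rw [Fin.succ_castSucc]))
        (hsub i.succ _ _ le_rfl (by linarith))
      have := ih.glue (by linarith) (by linarith) hs
      convert this using 1
      rw [Fin.val_succ, Fin.val_castSucc]
      push_cast
      ring
  have hl := hlt (Fin.last k)
  have h0 := hnn (Fin.last k).castSucc
  rw [Fin.succ_last, hylam] at hl
  have hlast := hmid (Fin.last k)
  rw [Fin.succ_last, hylam] at hlast
  refine ⟨c 0, c (Fin.last k), ?_⟩
  simpa using hlast.glue (by linarith) (by linarith) (HasRecovery.const hcont (b := lam)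
    (by linarith) (hwell (Fin.last k)).1 (hwell (Fin.last k)).2
    (hsub (Fin.last k) _ _ (by linarith) (by rw [Fin.succ_last, hylam])) eps)

/-- Limsup (recovery sequence) inequality of the Γ-convergence of the rescaled
energies `I_ε[H] = ∫₀^λ (ε/2 (H')² + (1/ε) W*(H)) dy` under the constraint
`∫₀^λ H = 1`: for every `{0,1}`-valued step function `H` with exactly `k`
jumps and `∫₀^λ H = 1`, and every `εₙ → 0`, there is a recovery sequence
`Hₙ ∈ H¹(0,λ)`, `Hₙ ≥ 0` a.e., `∫₀^λ Hₙ = 1`, with `Hₙ → H` in `L¹(0,λ)` and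
`I_{εₙ}[Hₙ] → k C_{W*}`. -/
theorem stmt_6
    (lam : ℝ) (hlam : 1 ≤ lam)
    (Wstar : ℝ → ℝ)
    (hWs_cont : ContinuousOn Wstar (Ici 0))
    (hWs_nonneg : ∀ H : ℝ, 0 ≤ H → 0 ≤ Wstar H)
    (hWs_zero : ∀ H : ℝ, 0 ≤ H → (Wstar H = 0 ↔ H = 0 ∨ H = 1))
    (C M : ℝ) (hC : 0 < C) (hM : 1 < M)
    (hgrowth : ∀ H : ℝ, M ≤ H → C * H ^ 2 ≤ Wstar H)
    (Hlim : ℝ → ℝ) (k : ℕ) (hstep : IsStepOn lam Hlim k)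
    (hcompat : (∫ y in (0:ℝ)..lam, Hlim y) = 1)
    (eps : ℕ → ℝ) (heps_pos : ∀ n, 0 < eps n)
    (heps0 : Tendsto eps atTop (nhds 0)) :
    ∃ Hn Hd : ℕ → ℝ → ℝ,
      (∀ n, ∀ y ∈ Icc (0:ℝ) lam,
        Hn n y = Hn n 0 + ∫ t in (0:ℝ)..y, Hd n t) ∧
      (∀ n, IntervalIntegrable (Hd n) volume 0 lam) ∧
      (∀ n, IntervalIntegrable (fun y => (Hd n y) ^ 2) volume 0 lam) ∧
      (∀ n, IntervalIntegrable (fun y => Wstar (Hn n y)) volume 0 lam) ∧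
      (∀ n, ∀ᵐ y ∂(volume.restrict (Ioo (0:ℝ) lam)), 0 ≤ Hn n y) ∧
      (∀ n, (∫ y in (0:ℝ)..lam, Hn n y) = 1) ∧
      Tendsto (fun n => ∫ y in (0:ℝ)..lam, |Hn n y - Hlim y|)
        atTop (nhds 0) ∧
      Tendsto (fun n => ∫ y in (0:ℝ)..lam,
          (eps n / 2 * (Hd n y) ^ 2 + (1 / eps n) * Wstar (Hn n y)))
        atTop
        (nhds ((k : ℝ) * ∫ τ in (0:ℝ)..1, Real.sqrt (2 * Wstar τ))) := by
  have hW0 : Wstar 0 = 0 := (hWs_zero 0 le_rfl).2 (Or.inl rfl)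
  have hW1 : Wstar 1 = 0 := (hWs_zero 1 zero_le_one).2 (Or.inr rfl)
  obtain ⟨p, q, L, E, hC, hL, hE⟩ :=
    HasRecovery.of_isStepOn hWs_cont hWs_nonneg hW0 hW1 heps_pos heps0 hstep
  choose f g hf0 _ hf hg hg2 hW hfnn hfH hmass hdist henergy using hC
  have hlam0 : 0 ≤ lam := zero_le_one.trans hlam
  have hHint : IntervalIntegrable Hlim volume 0 lam := by
    by_contra hnot
    exact one_ne_zero (hcompat.symm.trans (integral_undef hnot))
  refine ⟨f, g, fun n y hy => by rw [hf0 n, hf n y hy], hg, hg2, hW, fun n => ?_, fun n => ?_,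
    by simpa only [hdist] using hL, by simpa only [henergy] using hE⟩
  · exact (ae_restrict_iff' measurableSet_Ioo).2
      (Eventually.of_forall fun y hy => hfnn n y (Ioo_subset_Icc_self hy))
  · have hsum := integral_add (hfH n) hHint
    simpa [hmass n, hcompat] using hsum
end

section
/- Let λ ≥ 1 and μ > 0. Let W* : [0,∞) → [0,∞) be continuous with W*(H) = 0 if and only if H ∈ {0,1}, and suppose there exist C > 0 and M > 1 with W*(H) ≥ C·H² for all H ≥ M. Set C_{W*} := ∫₀¹ √(2W*(τ)) dτ. Let h be continuous and piecewise affine on [0,λ] with h′ a step function taking values in {0,1} with exactly k jumps, h(0) = 0, h(λ) = 1. Then for every sequence εₙ > 0 with εₙ → 0 there exists a recovery sequence hₙ ∈ H²(0,λ) with hₙ′ ≥ 0 a.e., hₙ(0) = 0, hₙ(λ) = 1, such that hₙ → h in H¹(0,λ) and ∫₀^λ ( (εₙ/2)(hₙ′′)² + (1/εₙ)W*(hₙ′) + (μ·hₙ′/2)(y − λhₙ)² ) dy → k·C_{W*} + (μ/2)∫₀^λ h′(y)(y − λh(y))² dy. -/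
open MeasureTheory Set Filter intervalIntegral

theorem intervalIntegrable_of_measurable_of_abs_le {f : ℝ → ℝ} (hf : Measurable f) {B : ℝ}
    (hB : ∀ t, |f t| ≤ B) (s t : ℝ) : IntervalIntegrable f volume s t :=
  (intervalIntegrable_const (c := B)).mono_fun hf.aestronglyMeasurable
    (Eventually.of_forall fun x => (hB x).trans (le_abs_self _))

/-- A global strictly increasing solution of the autonomous equation `g' = f ∘ g`, `g 0 = 0`,
for a continuous `f` bounded between two positive constants. -/
theorem exists_autonomous_solution {f : ℝ → ℝ} (hf : Continuous f) {m B : ℝ} (hm : 0 < m)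
    (hmf : ∀ s, m ≤ f s) (hfB : ∀ s, f s ≤ B) :
    ∃ g : ℝ → ℝ, StrictMono g ∧ Function.Surjective g ∧ g 0 = 0 ∧
      ∀ t, HasDerivAt g (f (g t)) t := by
  have hpos : ∀ s, 0 < f s := fun s => hm.trans_le (hmf s)
  have hB : 0 < B := (hpos 0).trans_le (hfB 0)
  have hinv : Continuous fun s => (f s)⁻¹ := hf.inv₀ fun s => (hpos s).ne'
  set G : ℝ → ℝ := fun u => ∫ x in (0:ℝ)..u, (f x)⁻¹ with hG
  have hGd : ∀ s, HasDerivAt G (f s)⁻¹ s := fun s =>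
    (hinv.integral_hasStrictDerivAt 0 s).hasDerivAt
  have hGdiff : Differentiable ℝ G := fun s => (hGd s).differentiableAt
  have hlow : ∀ ⦃x y : ℝ⦄, x ≤ y → B⁻¹ * (y - x) ≤ G y - G x :=
    mul_sub_le_image_sub_of_le_deriv hGdiff fun x => by
      rw [(hGd x).deriv]
      exact inv_anti₀ (hpos x) (hfB x)
  have hG0 : G 0 = 0 := by simp [hG]
  have hmono : StrictMono G := strictMono_of_deriv_pos fun x => by
    rw [(hGd x).deriv]
    exact inv_pos.mpr (hpos x)
  have htop : Tendsto G atTop atTop := by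
    refine tendsto_atTop_mono' _ ?_ (tendsto_id.const_mul_atTop (inv_pos.mpr hB))
    filter_upwards [eventually_ge_atTop 0] with x hx
    have := hlow hx
    simp only [hG0, sub_zero] at this
    exact this
  have hbot : Tendsto G atBot atBot := by
    refine tendsto_atBot_mono' _ ?_ (tendsto_id.const_mul_atBot (inv_pos.mpr hB))
    filter_upwards [eventually_le_atBot 0] with x hx
    have := hlow hx
    simp only [hG0, zero_sub] at this
    simp only [id]
    linarith
  have hsurj : Function.Surjective G := hGdiff.continuous.surjective htop hbot
  let e := hmono.orderIsoOfSurjective G hsurj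
  have hGe : ∀ t, G (e.symm t) = t := fun t => e.apply_symm_apply t
  refine ⟨e.symm, e.symm.strictMono, e.symm.surjective, ?_, fun t => ?_⟩
  · apply hmono.injective
    rw [hGe, hG0]
  · have := HasDerivAt.of_local_left_inverse (f := G) (g := e.symm) (a := t)
      e.symm.continuous.continuousAt (hGd _) (inv_ne_zero (hpos _).ne')
      (Eventually.of_forall hGe)
    simpa using this

/-- `Φ` is a transition layer from `a` to `b`, with derivative `ψ`, of half-width at most `√ε`,
having the same mean as the sharp step at `0` and almost optimal energy. -/
structure IsTransition (W : ℝ → ℝ) (ε a b : ℝ) (Φ ψ : ℝ → ℝ) : Prop where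
  cont : Continuous Φ
  mem : ∀ t, Φ t ∈ Icc (0:ℝ) 1
  left : ∀ t, t ≤ -√ε → Φ t = a
  right : ∀ t, √ε ≤ t → Φ t = b
  meas : Measurable ψ
  bdd : ∃ B, ∀ t, |ψ t| ≤ B
  supp : ∀ t, √ε ≤ |t| → ψ t = 0
  ftc : ∀ s t, ∫ u in s..t, ψ u = Φ t - Φ s
  mean : ∫ t, (Φ t - if 0 < t then b else a) = 0
  energy : |(∫ t, (ε / 2 * ψ t ^ 2 + 1 / ε * W (Φ t))) - ∫ τ in (0:ℝ)..1, √(2 * W τ)| ≤ √(2 * ε)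

theorem exists_transition_zero_one {W : ℝ → ℝ} (hW : ContinuousOn W (Ici 0))
    (hW_nonneg : ∀ s, 0 ≤ s → 0 ≤ W s) (hW0 : W 0 = 0) (hW1 : W 1 = 0) {ε : ℝ} (hε : 0 < ε) :
    ∃ Φ ψ, IsTransition W ε 0 1 Φ ψ := by
  set w : ℝ → ℝ := fun s => W (max 0 (min 1 s)) with hw
  have hwc : Continuous w :=
    hW.comp_continuous (by fun_prop) fun s => mem_Ici.mpr (le_max_left _ _)
  have hwn : ∀ s, 0 ≤ w s := fun s => hW_nonneg _ (le_max_left _ _)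
  have hwW : ∀ s ∈ Icc (0:ℝ) 1, w s = W s := fun s hs => by
    simp only [hw]
    rw [min_eq_right hs.2, max_eq_right hs.1]
  obtain ⟨K, hK⟩ : ∃ K, ∀ s, w s ≤ K := by
    obtain ⟨K, hK⟩ := (isCompact_Icc (a := (0:ℝ)) (b := 1)).bddAbove_image
      (hW.mono fun s hs => hs.1)
    exact ⟨K, fun s => hK ⟨_, ⟨le_max_left _ _, max_le zero_le_one (min_le_left _ _)⟩, rfl⟩⟩
  set f : ℝ → ℝ := fun s => √(2 * (w s + ε)) / ε with hf
  have hfc : Continuous f := by fun_prop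
  have hfm : ∀ s, √(2 * ε) / ε ≤ f s := fun s => by
    have := hwn s
    simp only [hf]
    gcongr
    linarith
  have hfB : ∀ s, f s ≤ √(2 * (K + ε)) / ε := fun s => by
    have := hK s
    simp only [hf]
    gcongr
  have hm : 0 < √(2 * ε) / ε := by positivity
  have hf0 : ∀ s, 0 < f s := fun s => hm.trans_le (hfm s)
  obtain ⟨g, gmono, gsurj, g0, gd⟩ := exists_autonomous_solution hfc hm hfm hfB
  obtain ⟨L, gL⟩ := gsurj 1
  have gdiff : Differentiable ℝ g := fun t => (gd t).differentiableAt
  have gc : Continuous g := gdiff.continuous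
  have hL0 : 0 < L := gmono.lt_iff_lt.mp (by rw [g0, gL]; norm_num)
  have hsqrt : ε = √ε * √ε := (Real.mul_self_sqrt hε.le).symm
  have hse : 0 < √ε := Real.sqrt_pos.mpr hε
  have hLε : L ≤ √ε := by
    have h1 : √(2 * ε) / ε * (L - 0) ≤ g L - g 0 :=
      mul_sub_le_image_sub_of_le_deriv gdiff (fun x => by rw [(gd x).deriv]; exact hfm _) hL0.le
    rw [g0, gL, sub_zero, sub_zero, div_mul_eq_mul_div, div_le_one hε] at h1
    have h2 : √ε ≤ √(2 * ε) := Real.sqrt_le_sqrt (by linarith)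
    have h3 : √ε * L ≤ √ε * √ε := (mul_le_mul_of_nonneg_right h2 hL0.le).trans (h1.trans hsqrt.le)
    exact le_of_mul_le_mul_left h3 hse
  set φ : ℝ → ℝ := fun t => max 0 (min 1 (g t)) with hφ
  have φc : Continuous φ := by fun_prop
  have φmem : ∀ t, φ t ∈ Icc (0:ℝ) 1 := fun t =>
    ⟨le_max_left _ _, max_le zero_le_one (min_le_left _ _)⟩
  have φleft : ∀ t, t ≤ 0 → φ t = 0 := fun t ht => by
    have : g t ≤ 0 := g0 ▸ gmono.monotone ht
    exact max_eq_left ((min_le_right _ _).trans this)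
  have φright : ∀ t, L ≤ t → φ t = 1 := fun t ht => by
    have : 1 ≤ g t := gL ▸ gmono.monotone ht
    simp only [hφ, min_eq_left this, zero_le_one, max_eq_right]
  have φmid : ∀ t ∈ Icc 0 L, φ t = g t := fun t ht => by
    have h1 : 0 ≤ g t := g0 ▸ gmono.monotone ht.1
    have h2 : g t ≤ 1 := gL ▸ gmono.monotone ht.2
    simp only [hφ, min_eq_right h2, max_eq_right h1]
  set ψ : ℝ → ℝ := (Ioo 0 L).indicator fun t => f (g t) with hψ
  have ψmeas : Measurable ψ := (hfc.comp gc).measurable.indicator measurableSet_Ioo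
  have ψbdd : ∀ t, |ψ t| ≤ √(2 * (K + ε)) / ε := fun t => by
    by_cases ht : t ∈ Ioo 0 L
    · rw [hψ, indicator_of_mem ht, abs_of_pos (hf0 _)]
      exact hfB _
    · rw [hψ, indicator_of_notMem ht, abs_zero]
      exact (hf0 0).le.trans (hfB 0)
  have ψint : ∀ s t, IntervalIntegrable ψ volume s t := fun s t =>
    intervalIntegrable_of_measurable_of_abs_le ψmeas ψbdd s t
  have φd : ∀ t, t ∉ ({0, L} : Set ℝ) → HasDerivAt φ (ψ t) t := fun t ht => by
    simp only [mem_insert_iff, mem_singleton_iff, not_or] at ht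
    rcases lt_or_gt_of_ne ht.1 with h | h
    · have : ψ t = 0 := indicator_of_notMem (fun h' => h'.1.not_gt h) _
      rw [this]
      refine (hasDerivAt_const t (0:ℝ)).congr_of_eventuallyEq ?_
      filter_upwards [Iio_mem_nhds h] with x hx using φleft x hx.le
    rcases lt_or_gt_of_ne ht.2 with h' | h'
    · have : ψ t = f (g t) := indicator_of_mem (mem_Ioo.mpr ⟨h, h'⟩) _
      rw [this]
      refine (gd t).congr_of_eventuallyEq ?_
      filter_upwards [Ioo_mem_nhds h h'] with x hx using φmid x ⟨hx.1.le, hx.2.le⟩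
    · have : ψ t = 0 := indicator_of_notMem (fun h'' => h''.2.not_gt h') _
      rw [this]
      refine (hasDerivAt_const t (1:ℝ)).congr_of_eventuallyEq ?_
      filter_upwards [Ioi_mem_nhds h'] with x hx using φright x hx.le
  have φftc : ∀ s t, ∫ u in s..t, ψ u = φ t - φ s := fun s t =>
    MeasureTheory.integral_eq_of_hasDerivAt_off_countable φ ψ (s := {0, L})
      ((countable_singleton L).insert 0) φc.continuousOn (fun x hx => φd x hx.2) (ψint s t)
  -- the shift making the mean equal to that of the sharp step
  set a : ℝ := L - ∫ t in (0:ℝ)..L, φ t with ha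
  have hI0 : 0 ≤ ∫ t in (0:ℝ)..L, φ t :=
    intervalIntegral.integral_nonneg hL0.le fun t _ => (φmem t).1
  have hI1 : ∫ t in (0:ℝ)..L, φ t ≤ L := by
    have := intervalIntegral.integral_mono_on (μ := volume) (f := φ) (g := fun _ => (1:ℝ)) hL0.le
      (φc.intervalIntegrable 0 L) intervalIntegrable_const fun t _ => (φmem t).2
    simpa using this
  have ha0 : 0 ≤ a := by linarith
  have haL : a ≤ L := by linarith
  have hmean : ∫ t, (φ t - if a < t then 1 else 0) = 0 := by
    rw [← intervalIntegral.integral_eq_integral_of_support_subset (a := 0) (b := L)]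
    · rw [intervalIntegral.integral_sub (φc.intervalIntegrable 0 L)]
      · have : ∀ x : ℝ, (if a < x then (1:ℝ) else 0) = (Ioi a).indicator (fun _ => (1:ℝ)) x :=
          fun x => by simp [indicator_apply]
        simp_rw [this]
        rw [intervalIntegral.integral_of_le hL0.le (f := (Ioi a).indicator _),
          setIntegral_indicator measurableSet_Ioi]
        have : Ioc 0 L ∩ Ioi a = Ioc a L := by
          ext x
          simp only [mem_inter_iff, mem_Ioc, mem_Ioi]
          constructor
          · rintro ⟨⟨_, h2⟩, h3⟩
            exact ⟨h3, h2⟩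
          · rintro ⟨h1, h2⟩
            exact ⟨⟨ha0.trans_lt h1, h2⟩, h1⟩
        rw [this]
        simp [haL]
        linarith
      · refine intervalIntegrable_of_measurable_of_abs_le
          (Measurable.ite measurableSet_Ioi measurable_const measurable_const) (B := 1)
          (fun x => ?_) _ _
        split_ifs <;> simp
    · intro t ht
      by_contra hn
      apply ht
      rw [mem_Ioc, not_and_or, not_lt, not_le] at hn
      rcases hn with h | h
      · simp [φleft t h, h.trans ha0]
      · simp [φright t h.le, haL.trans_lt h]
  have henergy : |(∫ t, (ε / 2 * ψ t ^ 2 + 1 / ε * W (φ t))) - ∫ τ in (0:ℝ)..1, √(2 * W τ)|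
      ≤ √(2 * ε) := by
    set q : ℝ → ℝ := fun s => (2 * w s + ε) / √(2 * (w s + ε)) with hq
    have hr : ∀ s, 0 < √(2 * (w s + ε)) := fun s =>
      Real.sqrt_pos.mpr (by have := hwn s; linarith)
    have hqc : Continuous q := by
      refine Continuous.div (by fun_prop) (by fun_prop) fun s => (hr s).ne'
    have h1 : ∫ t, (ε / 2 * ψ t ^ 2 + 1 / ε * W (φ t)) = ∫ s in (0:ℝ)..1, q s := by
      have hsub := intervalIntegral.integral_comp_mul_deriv (a := 0) (b := L) (f := g)
        (f' := fun t => f (g t)) (g := q) (fun x _ => gd x) (hfc.comp gc).continuousOn hqc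
      rw [g0, gL] at hsub
      rw [← hsub, intervalIntegral.integral_of_le hL0.le, integral_Ioc_eq_integral_Ioo,
        ← setIntegral_eq_integral_of_forall_compl_eq_zero (s := Ioo 0 L)]
      · refine setIntegral_congr_fun measurableSet_Ioo fun t ht => ?_
        have e1 : ψ t = f (g t) := indicator_of_mem ht _
        have e2 : W (φ t) = w (g t) := rfl
        have e3 : √(2 * (w (g t) + ε)) ^ 2 = 2 * (w (g t) + ε) :=
          Real.sq_sqrt (by have := hwn (g t); linarith)
        simp only [e1, e2, Function.comp_apply, hf, hq]
        rw [div_pow, e3]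
        have := (hr (g t)).ne'
        field_simp
        ring
      · intro t ht
        have e1 : ψ t = 0 := indicator_of_notMem ht _
        have e2 : W (φ t) = 0 := by
          rw [mem_Ioo, not_and_or, not_lt, not_lt] at ht
          rcases ht with h | h
          · rw [φleft t h, hW0]
          · rw [φright t h, hW1]
        simp [e1, e2]
    have h2 : ∫ τ in (0:ℝ)..1, √(2 * W τ) = ∫ τ in (0:ℝ)..1, √(2 * w τ) := by
      refine intervalIntegral.integral_congr fun s hs => ?_
      rw [uIcc_of_le zero_le_one] at hs
      simp only [hwW s hs]
    have hc2 : Continuous fun s => √(2 * w s) := by fun_prop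
    rw [h1, h2, ← intervalIntegral.integral_sub (hqc.intervalIntegrable _ _)
      (hc2.intervalIntegrable _ _)]
    have hb : ∀ s, |q s - √(2 * w s)| ≤ √(2 * ε) := fun s => by
      have hws := hwn s
      have hlow : √(2 * w s) ≤ q s := by
        simp only [hq]
        rw [le_div_iff₀ (hr s), ← Real.sqrt_mul (by linarith)]
        refine Real.sqrt_le_iff.mpr ⟨by linarith, ?_⟩
        nlinarith
      have hup : q s ≤ √(2 * w s) + √(2 * ε) := by
        have h3 : q s ≤ √(2 * (w s + ε)) := by
          simp only [hq]
          rw [div_le_iff₀ (hr s), Real.mul_self_sqrt (by linarith)]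
          linarith
        refine h3.trans ?_
        rw [mul_add]
        have e1 := Real.sq_sqrt (show 0 ≤ 2 * w s by linarith)
        have e2 := Real.sq_sqrt (show 0 ≤ 2 * ε by linarith)
        refine Real.sqrt_le_iff.mpr ⟨by positivity, ?_⟩
        nlinarith [mul_nonneg (Real.sqrt_nonneg (2 * w s)) (Real.sqrt_nonneg (2 * ε))]
      rw [abs_of_nonneg (by linarith)]
      linarith
    have := intervalIntegral.norm_integral_le_of_norm_le_const (a := (0:ℝ)) (b := 1)
      (f := fun s => q s - √(2 * w s)) (C := √(2 * ε)) fun s _ => hb s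
    simpa using this
  refine ⟨fun t => φ (t + a), fun t => ψ (t + a), ?_⟩
  exact
    { cont := by fun_prop
      mem := fun t => φmem _
      left := fun t ht => φleft _ (by linarith)
      right := fun t ht => φright _ (by linarith)
      meas := ψmeas.comp (by fun_prop)
      bdd := ⟨_, fun t => ψbdd _⟩
      supp := fun t ht => by
        refine indicator_of_notMem (fun h => ?_) _
        have h1 := h.1
        have h2 := h.2
        rcases le_abs.mp ht with h' | h' <;> linarith
      ftc := fun s t => by
        rw [intervalIntegral.integral_comp_add_right, φftc]
      mean := by
        have := integral_add_right_eq_self (fun t => φ t - if a < t then 1 else 0) (μ := volume) a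
        rw [hmean] at this
        simpa only [lt_add_iff_pos_left] using this
      energy := by
        rw [integral_add_right_eq_self (fun t => ε / 2 * ψ t ^ 2 + 1 / ε * W (φ t)) a]
        exact henergy }

theorem IsTransition.reflect {W : ℝ → ℝ} {ε a b : ℝ} {Φ ψ : ℝ → ℝ}
    (h : IsTransition W ε a b Φ ψ) :
    IsTransition W ε b a (fun t => Φ (-t)) (fun t => -ψ (-t)) where
  cont := h.cont.comp continuous_neg
  mem t := h.mem _
  left t ht := h.right _ (by linarith)
  right t ht := h.left _ (by linarith)
  meas := (h.meas.comp measurable_neg).neg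
  bdd := by
    obtain ⟨B, hB⟩ := h.bdd
    exact ⟨B, fun t => by rw [abs_neg]; exact hB _⟩
  supp t ht := by
    rw [h.supp _ (by rwa [abs_neg]), neg_zero]
  ftc s t := by
    rw [intervalIntegral.integral_neg, intervalIntegral.integral_comp_neg, h.ftc]
    ring
  mean := by
    have := integral_neg_eq_self (fun t => Φ t - if 0 < t then b else a) volume
    rw [h.mean] at this
    refine Eq.trans (integral_congr_ae ?_) this
    filter_upwards [Measure.ae_ne volume (0:ℝ)] with t ht
    rcases lt_or_gt_of_ne ht with h' | h'
    · simp [h', h'.not_gt]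
    · simp [h', h'.not_gt]
  energy := by
    have := integral_neg_eq_self (fun t => ε / 2 * ψ t ^ 2 + 1 / ε * W (Φ t)) volume
    simp only [neg_sq]
    rw [this]
    exact h.energy

theorem exists_transition_s9 {W : ℝ → ℝ} (hW : ContinuousOn W (Ici 0))
    (hW_nonneg : ∀ s, 0 ≤ s → 0 ≤ W s) (hW0 : W 0 = 0) (hW1 : W 1 = 0) {ε : ℝ} (hε : 0 < ε)
    {a b : ℝ} (ha : a = 0 ∨ a = 1) (hb : b = 0 ∨ b = 1) (hab : a ≠ b) :
    ∃ Φ ψ, IsTransition W ε a b Φ ψ := by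
  obtain ⟨Φ, ψ, h⟩ := exists_transition_zero_one hW hW_nonneg hW0 hW1 hε
  rcases ha with rfl | rfl <;> rcases hb with rfl | rfl
  · exact absurd rfl hab
  · exact ⟨Φ, ψ, h⟩
  · exact ⟨_, _, h.reflect⟩
  · exact absurd rfl hab

theorem add_sum_range_sub_eq_of_eq_off {c F : ℕ → ℝ} {j k : ℕ} (hj : j ≤ k)
    (h1 : ∀ i < j, F i = c (i + 1)) (h2 : ∀ i, j < i → i < k → F i = c i) :
    c 0 + ∑ i ∈ Finset.range k, (F i - c i) = if j < k then F j else c k := by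
  have hpre : ∑ i ∈ Finset.range j, (F i - c i) = c j - c 0 := by
    rw [← Finset.sum_range_sub]
    exact Finset.sum_congr rfl fun i hi => by rw [h1 i (Finset.mem_range.mp hi)]
  rw [← Finset.sum_range_add_sum_Ico _ hj, hpre]
  split_ifs with hjk
  · rw [Finset.sum_eq_sum_Ico_succ_bot hjk, Finset.sum_eq_zero]
    · ring
    · intro i hi
      rw [Finset.mem_Ico] at hi
      rw [h2 i (by omega) hi.2, sub_self]
  · obtain rfl : j = k := by omega
    simp

theorem exists_index_forall_le_and_forall_lt {z : ℕ → ℝ} {k : ℕ}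
    (hz : ∀ i j, i < j → j < k → z i ≤ z j) (t : ℝ) :
    ∃ j ≤ k, (∀ i < j, z i ≤ t) ∧ ∀ i, j ≤ i → i < k → t < z i := by
  by_cases h : ∃ i, i < k ∧ t < z i
  · classical
    refine ⟨Nat.find h, (Nat.find_spec h).1.le, fun i hi => ?_, fun i hi hik => ?_⟩
    · by_contra hlt
      exact Nat.find_min h hi ⟨hi.trans (Nat.find_spec h).1, not_le.mp hlt⟩
    · rcases hi.eq_or_lt with h' | h'
      · exact h' ▸ (Nat.find_spec h).2
      · exact (Nat.find_spec h).2.trans_le (hz _ _ h' hik)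
  · push Not at h
    exact ⟨k, le_rfl, h, fun i h1 h2 => absurd h2 h1.not_gt⟩

theorem intervalIntegrable_finsetSum {ι : Type*} {s : Finset ι} {f : ι → ℝ → ℝ} {a b : ℝ}
    (h : ∀ i ∈ s, IntervalIntegrable (f i) volume a b) :
    IntervalIntegrable (fun t => ∑ i ∈ s, f i t) volume a b := by
  have := IntervalIntegrable.sum s h
  rwa [show (fun t => ∑ i ∈ s, f i t) = ∑ i ∈ s, f i by ext; simp]

theorem ae_exists_mem_Ioo_of_forall_ae {lam : ℝ} {k : ℕ} {Y c : ℕ → ℝ} (hY0 : Y 0 = 0)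
    (hYlam : Y (k + 1) = lam) (hY : ∀ i j, i ≤ j → j ≤ k + 1 → Y i ≤ Y j) {Dh : ℝ → ℝ}
    (hDh : ∀ i ≤ k, ∀ᵐ t, t ∈ Ioo (Y i) (Y (i + 1)) → Dh t = c i) :
    ∀ᵐ t, t ∈ Ioc 0 lam → ∃ j ≤ k, t ∈ Ioo (Y j) (Y (j + 1)) ∧ Dh t = c j := by
  have hall : ∀ᵐ t, ∀ i, i ≤ k → t ∈ Ioo (Y i) (Y (i + 1)) → Dh t = c i := by
    rw [ae_all_iff]
    intro i
    by_cases hi : i ≤ k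
    · filter_upwards [hDh i hi] with t ht _ using ht
    · exact Eventually.of_forall fun t h => absurd h hi
  have hne : ∀ᵐ t, ∀ i, t ≠ Y i := by
    rw [ae_all_iff]
    exact fun i => Measure.ae_ne volume (Y i)
  filter_upwards [hall, hne] with t h1 h2 ht
  obtain ⟨j, hj, h3, h4⟩ := exists_index_forall_le_and_forall_lt (z := fun i => Y (i + 1))
    (k := k) (fun i j hij hj => hY _ _ (by omega) (by omega)) t
  have hjlt : t < Y (j + 1) := by
    rcases hj.eq_or_lt with rfl | hjk
    · exact lt_of_le_of_ne (ht.2.trans hYlam.ge) (h2 _)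
    · exact h4 j le_rfl hjk
  have hjgt : Y j < t := by
    refine lt_of_le_of_ne ?_ (h2 _).symm
    rcases Nat.eq_zero_or_pos j with rfl | hpos
    · exact hY0 ▸ ht.1.le
    · have := h3 (j - 1) (by omega)
      rwa [Nat.sub_add_cancel hpos] at this
  exact ⟨j, hj, ⟨hjgt, hjlt⟩, h1 j hj ⟨hjgt, hjlt⟩⟩

theorem exists_smoothed_step {W : ℝ → ℝ} (hW : ContinuousOn W (Ici 0))
    (hW_nonneg : ∀ s, 0 ≤ s → 0 ≤ W s) (hW0 : W 0 = 0) (hW1 : W 1 = 0)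
    {lam : ℝ} {k : ℕ} {Y c : ℕ → ℝ} (hY0 : Y 0 = 0) (hYlam : Y (k + 1) = lam)
    {d : ℝ} (hgap : ∀ i ≤ k, Y i + d ≤ Y (i + 1))
    (hc : ∀ i ≤ k, c i = 0 ∨ c i = 1) (hjump : ∀ i < k, c i ≠ c (i + 1))
    {Dh : ℝ → ℝ}
    (hDh : ∀ i ≤ k, ∀ᵐ t, t ∈ Ioo (Y i) (Y (i + 1)) → Dh t = c i)
    {ε : ℝ} (hε : 0 < ε) (hεd : 2 * √ε ≤ d) :
    ∃ p q : ℝ → ℝ, Continuous p ∧ (∀ t, p t ∈ Icc (0:ℝ) 1) ∧ Measurable q ∧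
      (∃ B, ∀ t, |q t| ≤ B) ∧ (∀ s t, ∫ u in s..t, q u = p t - p s) ∧
      (∫ t in (0:ℝ)..lam, p t = ∫ t in (0:ℝ)..lam, Dh t) ∧
      (∫ t in (0:ℝ)..lam, |p t - Dh t| ≤ k * (2 * √ε)) ∧
      |(∫ t in (0:ℝ)..lam, (ε / 2 * q t ^ 2 + 1 / ε * W (p t))) -
        k * ∫ τ in (0:ℝ)..1, √(2 * W τ)| ≤ k * √(2 * ε) := by
  have hWc : ∀ i ≤ k, W (c i) = 0 := fun i hi => by
    rcases hc i hi with h | h <;> rw [h] <;> assumption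
  have hr : 0 < √ε := Real.sqrt_pos.mpr hε
  have hYlt : ∀ i j, i < j → j ≤ k + 1 → Y i + d ≤ Y j := by
    intro i j hij
    induction j, hij using Nat.le_induction with
    | base => intro h; exact hgap i (by omega)
    | succ n hn ih =>
      intro h
      have := hgap n (by omega)
      have := ih (by omega)
      linarith
  have hYle : ∀ i j, i ≤ j → j ≤ k + 1 → Y i ≤ Y j := fun i j hij hj => by
    rcases hij.eq_or_lt with rfl | h
    · exact le_rfl
    · linarith [hYlt i j h hj]
  have hlam : 0 ≤ lam := by
    have := hYlt 0 (k + 1) (by omega) le_rfl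
    linarith
  have htrans : ∀ i, ∃ Φ ψ, i < k → IsTransition W ε (c i) (c (i + 1)) Φ ψ := fun i => by
    by_cases hi : i < k
    · obtain ⟨Φ, ψ, h⟩ := exists_transition_s9 hW hW_nonneg hW0 hW1 hε (hc i hi.le)
        (hc (i + 1) hi) (hjump i hi)
      exact ⟨Φ, ψ, fun _ => h⟩
    · exact ⟨0, 0, fun h => absurd h hi⟩
  choose Φ ψ hΦ using htrans
  set F : ℕ → ℝ → ℝ := fun i t => Φ i (t - Y (i + 1)) with hF
  set P : ℕ → ℝ → ℝ := fun i t => ψ i (t - Y (i + 1)) with hP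
  set S : ℕ → ℝ → ℝ := fun i t => if 0 < t - Y (i + 1) then c (i + 1) else c i with hS
  set p : ℝ → ℝ := fun t => c 0 + ∑ i ∈ Finset.range k, (F i t - c i) with hp
  set q : ℝ → ℝ := fun t => ∑ i ∈ Finset.range k, P i t with hq
  set D : ℝ → ℝ := fun t => c 0 + ∑ i ∈ Finset.range k, (S i t - c i) with hD
  have hFc : ∀ i < k, Continuous (F i) := fun i hi => (hΦ i hi).cont.comp (by fun_prop)
  have hPm : ∀ i < k, Measurable (P i) := fun i hi => (hΦ i hi).meas.comp (by fun_prop)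
  have hSm : ∀ i, Measurable (S i) := fun i =>
    Measurable.ite (measurableSet_lt measurable_const (by fun_prop)) measurable_const
      measurable_const
  have hSb : ∀ i < k, ∀ t, S i t ∈ Icc (0:ℝ) 1 := fun i hi t => by
    have h0 := hc i hi.le
    have h1 := hc (i + 1) hi
    simp only [hS]
    split_ifs
    · rcases h1 with h | h <;> rw [h] <;> simp
    · rcases h0 with h | h <;> rw [h] <;> simp
  have hFS : ∀ i < k, ∀ t, |F i t - S i t| ≤ 1 := fun i hi t => by
    have h1 := (hΦ i hi).mem (t - Y (i + 1))
    have h2 := hSb i hi t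
    exact abs_le.mpr ⟨by linarith [h1.1, h2.2], by linarith [h1.2, h2.1]⟩
  have hSint : ∀ i < k, ∀ s t, IntervalIntegrable (S i) volume s t := fun i hi s t =>
    intervalIntegrable_of_measurable_of_abs_le (hSm i) (B := 1)
      (fun x => abs_le.mpr ⟨by linarith [(hSb i hi x).1], (hSb i hi x).2⟩) s t
  have hFSint : ∀ i < k, ∀ s t, IntervalIntegrable (fun t => F i t - S i t) volume s t :=
    fun i hi s t => ((hFc i hi).intervalIntegrable s t).sub (hSint i hi s t)
  have hDint : ∀ s t, IntervalIntegrable D volume s t := fun s t =>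
    intervalIntegrable_const.add (intervalIntegrable_finsetSum fun i hi =>
      (hSint i (Finset.mem_range.mp hi) s t).sub intervalIntegrable_const)
  have hpc : Continuous p := continuous_const.add (continuous_finsetSum _ fun i hi =>
    (hFc i (Finset.mem_range.mp hi)).sub continuous_const)
  have hqm : Measurable q := Finset.measurable_fun_sum _ fun i hi =>
    hPm i (Finset.mem_range.mp hi)
  -- at each point at most one layer is active
  have hloc : ∀ t, ∃ j ≤ k, (∀ i < j, √ε ≤ t - Y (i + 1)) ∧
      ∀ i, j < i → i < k → t - Y (i + 1) ≤ -√ε := fun t => by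
    obtain ⟨j, hj, h1, h2⟩ := exists_index_forall_le_and_forall_lt (z := fun i => Y (i + 1) + √ε)
      (k := k) (fun i j hij hj => by
        have := hYlt (i + 1) (j + 1) (by omega) (by omega)
        linarith) t
    refine ⟨j, hj, fun i hi => by have := h1 i hi; linarith,
      fun i hij hik => ?_⟩
    have h3 := h2 j le_rfl (by omega)
    have h4 := hYlt (j + 1) (i + 1) (by omega) (by omega)
    linarith
  have hpt : ∀ t, ∃ j ≤ k, (p t = if j < k then F j t else c k) ∧
      (∀ i < k, i ≠ j → P i t = 0 ∧ W (F i t) = 0) := fun t => by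
    obtain ⟨j, hj, h1, h2⟩ := hloc t
    refine ⟨j, hj, ?_, fun i hi hij => ?_⟩
    · exact add_sum_range_sub_eq_of_eq_off hj
        (fun i hi => (hΦ i (by omega)).right _ (h1 i hi))
        (fun i hij hik => (hΦ i hik).left _ (h2 i hij hik))
    · rcases lt_or_gt_of_ne hij with h | h
      · refine ⟨(hΦ i hi).supp _ ((h1 i h).trans (le_abs_self _)), ?_⟩
        have : F i t = c (i + 1) := (hΦ i hi).right _ (h1 i h)
        rw [this, hWc _ hi]
      · have h3 := h2 i h hi
        refine ⟨(hΦ i hi).supp _ (le_abs.mpr (Or.inr (by linarith))), ?_⟩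
        have : F i t = c i := (hΦ i hi).left _ h3
        rw [this, hWc _ hi.le]
  have hpmem : ∀ t, p t ∈ Icc (0:ℝ) 1 := fun t => by
    obtain ⟨j, hj, h1, -⟩ := hpt t
    rw [h1]
    split_ifs with h
    · exact (hΦ j h).mem _
    · rcases hc k le_rfl with h | h <;> rw [h] <;> simp
  have hen : ∀ t, ε / 2 * q t ^ 2 + 1 / ε * W (p t) =
      ∑ i ∈ Finset.range k, (ε / 2 * P i t ^ 2 + 1 / ε * W (F i t)) := fun t => by
    obtain ⟨j, hj, h1, h2⟩ := hpt t
    by_cases h : j < k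
    · have hmem := Finset.mem_range.mpr h
      rw [if_pos h] at h1
      have hqt : q t = P j t := Finset.sum_eq_single_of_mem j hmem fun i hi hij =>
        (h2 i (Finset.mem_range.mp hi) hij).1
      rw [h1, hqt, Finset.sum_eq_single_of_mem j hmem]
      intro i hi hij
      obtain ⟨e1, e2⟩ := h2 i (Finset.mem_range.mp hi) hij
      rw [e1, e2]
      ring
    · rw [if_neg h] at h1
      have hz : ∀ i ∈ Finset.range k, P i t = 0 ∧ W (F i t) = 0 := fun i hi => by
        have := Finset.mem_range.mp hi
        exact h2 i this (by omega)
      have hqt : q t = 0 := Finset.sum_eq_zero fun i hi => (hz i hi).1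
      rw [h1, hqt, hWc k le_rfl, Finset.sum_eq_zero]
      · ring
      · intro i hi
        obtain ⟨e1, e2⟩ := hz i hi
        rw [e1, e2]
        ring
  have hDhD : ∀ᵐ t, t ∈ uIoc 0 lam → Dh t = D t := by
    filter_upwards [ae_exists_mem_Ioo_of_forall_ae hY0 hYlam hYle hDh] with t h1 ht
    obtain ⟨j, hj, ⟨h2, h3⟩, h4⟩ := h1 (uIoc_of_le hlam ▸ ht)
    have hDt : D t = if j < k then S j t else c k :=
      add_sum_range_sub_eq_of_eq_off hj
        (fun i hi => if_pos (sub_pos.mpr ((hYle (i + 1) j (by omega) (by omega)).trans_lt h2)))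
        (fun i hij hik => if_neg
          (by linarith [hYle (j + 1) (i + 1) (by omega) (by omega)]))
    rw [h4, hDt]
    split_ifs with h
    · exact (if_neg (by linarith)).symm
    · rw [show j = k by omega]
  have hpD : ∀ t, p t - D t = ∑ i ∈ Finset.range k, (F i t - S i t) := fun t => by
    simp only [hp, hD]
    rw [add_sub_add_left_eq_sub, ← Finset.sum_sub_distrib]
    exact Finset.sum_congr rfl fun i _ => by ring
  have hYin : ∀ i < k, √ε < Y (i + 1) ∧ Y (i + 1) + √ε ≤ lam := fun i hi => by
    have h1 := hYlt 0 (i + 1) (by omega) (by omega)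
    have h2 := hYlt (i + 1) (k + 1) (by omega) (by omega)
    constructor <;> linarith
  have hoff : ∀ i < k, ∀ t, t ∉ Ioc (Y (i + 1) - √ε) (Y (i + 1) + √ε) →
      F i t - S i t = 0 ∧ P i t = 0 ∧ W (F i t) = 0 := fun i hi t ht => by
    rw [mem_Ioc, not_and_or, not_lt, not_le] at ht
    rcases ht with h | h
    · have e1 : F i t = c i := (hΦ i hi).left _ (by linarith)
      have e2 : S i t = c i := if_neg (by linarith)
      exact ⟨by rw [e1, e2, sub_self],
        (hΦ i hi).supp _ (le_abs.mpr (Or.inr (by linarith))), by rw [e1, hWc _ hi.le]⟩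
    · have e1 : F i t = c (i + 1) := (hΦ i hi).right _ (by linarith)
      have e2 : S i t = c (i + 1) := if_pos (by linarith)
      exact ⟨by rw [e1, e2, sub_self],
        (hΦ i hi).supp _ (le_abs.mpr (Or.inl (by linarith))), by rw [e1, hWc _ hi]⟩
  have hsub : ∀ i < k, Ioc (Y (i + 1) - √ε) (Y (i + 1) + √ε) ⊆ Ioc 0 lam := fun i hi =>
    Ioc_subset_Ioc (by linarith [(hYin i hi).1]) (hYin i hi).2
  have hFSsupp : ∀ i < k, Function.support (fun t => F i t - S i t) ⊆
      Ioc (Y (i + 1) - √ε) (Y (i + 1) + √ε) := fun i hi t ht => by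
    by_contra hn
    exact ht (hoff i hi t hn).1
  refine ⟨p, q, hpc, hpmem, hqm, ?_, ?_, ?_, ?_, ?_⟩
  · choose! B hB using fun i (hi : i < k) => (hΦ i hi).bdd
    refine ⟨∑ i ∈ Finset.range k, B i, fun t => (Finset.abs_sum_le_sum_abs _ _).trans ?_⟩
    exact Finset.sum_le_sum fun i hi => hB i (Finset.mem_range.mp hi) _
  · intro s t
    simp only [hq, hp]
    rw [intervalIntegral.integral_finsetSum, add_sub_add_left_eq_sub, ← Finset.sum_sub_distrib]
    · refine Finset.sum_congr rfl fun i hi => ?_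
      simp only [hP, hF]
      rw [intervalIntegral.integral_comp_sub_right, (hΦ i (Finset.mem_range.mp hi)).ftc]
      ring
    · intro i hi
      have hi' := Finset.mem_range.mp hi
      obtain ⟨B, hB⟩ := (hΦ i hi').bdd
      exact intervalIntegrable_of_measurable_of_abs_le (hPm i hi') (fun x => hB _) s t
  · rw [intervalIntegral.integral_congr_ae hDhD, ← sub_eq_zero,
      ← intervalIntegral.integral_sub (hpc.intervalIntegrable _ _) (hDint _ _)]
    simp_rw [hpD]
    rw [intervalIntegral.integral_finsetSum fun i hi => hFSint i (Finset.mem_range.mp hi) _ _]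
    refine Finset.sum_eq_zero fun i hi => ?_
    have hi' := Finset.mem_range.mp hi
    rw [intervalIntegral.integral_eq_integral_of_support_subset
      ((hFSsupp i hi').trans (hsub i hi'))]
    have := integral_sub_right_eq_self
      (fun t => Φ i t - if 0 < t then c (i + 1) else c i) (μ := volume) (Y (i + 1))
    rw [(hΦ i hi').mean] at this
    exact this
  · have h1 : ∫ t in (0:ℝ)..lam, |p t - Dh t| = ∫ t in (0:ℝ)..lam, |p t - D t| := by
      refine intervalIntegral.integral_congr_ae ?_
      filter_upwards [hDhD] with t ht hmem
      rw [ht hmem]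
    have h2 : ∫ t in (0:ℝ)..lam, |p t - D t| ≤
        ∫ t in (0:ℝ)..lam, ∑ i ∈ Finset.range k, |F i t - S i t| := by
      refine intervalIntegral.integral_mono_on hlam
        ((hpc.intervalIntegrable _ _).sub (hDint _ _)).abs
        (intervalIntegrable_finsetSum fun i hi => (hFSint i (Finset.mem_range.mp hi) _ _).abs)
        fun t _ => ?_
      rw [hpD]
      exact Finset.abs_sum_le_sum_abs _ _
    rw [h1]
    refine h2.trans ?_
    rw [intervalIntegral.integral_finsetSum
      fun i hi => (hFSint i (Finset.mem_range.mp hi) _ _).abs]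
    have h3 : ∀ i ∈ Finset.range k, ∫ t in (0:ℝ)..lam, |F i t - S i t| ≤ 2 * √ε := fun i hi => by
      have hi' := Finset.mem_range.mp hi
      have hs : Function.support (fun t => |F i t - S i t|) ⊆
          Ioc (Y (i + 1) - √ε) (Y (i + 1) + √ε) := fun t ht => by
        by_contra hn
        exact ht (by simp only [(hoff i hi' t hn).1, abs_zero])
      rw [intervalIntegral.integral_eq_integral_of_support_subset (hs.trans (hsub i hi')),
        ← intervalIntegral.integral_eq_integral_of_support_subset hs]
      refine (Real.le_norm_self _).trans
        ((intervalIntegral.norm_integral_le_of_norm_le_const (C := 1) fun t _ => ?_).trans ?_)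
      · rw [Real.norm_eq_abs, abs_abs]
        exact hFS i hi' t
      · rw [one_mul, abs_of_nonneg (by linarith)]
        linarith
    simpa using Finset.sum_le_sum h3
  · have h_int : ∀ i ∈ Finset.range k, IntervalIntegrable
        (fun t => ε / 2 * P i t ^ 2 + 1 / ε * W (F i t)) volume 0 lam := fun i hi => by
      have hi' := Finset.mem_range.mp hi
      obtain ⟨B, hB⟩ := (hΦ i hi').bdd
      refine IntervalIntegrable.add (IntervalIntegrable.const_mul ?_ _)
        (IntervalIntegrable.const_mul ?_ _)
      · refine intervalIntegrable_of_measurable_of_abs_le ((hPm i hi').pow_const 2)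
          (B := B ^ 2) (fun x => ?_) _ _
        rw [abs_pow]
        exact pow_le_pow_left₀ (abs_nonneg _) (hB _) 2
      · exact (hW.comp_continuous (hFc i hi')
          fun t => ((hΦ i hi').mem _).1).intervalIntegrable _ _
    simp_rw [hen]
    rw [intervalIntegral.integral_finsetSum h_int]
    have hconst : ∀ x : ℝ, (k : ℝ) * x = ∑ _i ∈ Finset.range k, x := fun x => by simp
    rw [hconst, hconst, ← Finset.sum_sub_distrib]
    refine (Finset.abs_sum_le_sum_abs _ _).trans (Finset.sum_le_sum fun i hi => ?_)
    have hi' := Finset.mem_range.mp hi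
    rw [intervalIntegral.integral_eq_integral_of_support_subset]
    · simp only [hP, hF]
      rw [integral_sub_right_eq_self (fun t => ε / 2 * ψ i t ^ 2 + 1 / ε * W (Φ i t)) (Y (i + 1))]
      exact (hΦ i hi').energy
    · refine Subset.trans (fun t ht => ?_) (hsub i hi')
      by_contra hn
      obtain ⟨-, e1, e2⟩ := hoff i hi' t hn
      exact ht (by simp [e1, e2])

theorem abs_primitive_sub_le {lam : ℝ} {f g : ℝ → ℝ}
    (hf : IntervalIntegrable f volume 0 lam) (hg : IntervalIntegrable g volume 0 lam)
    {t : ℝ} (ht : t ∈ Icc 0 lam) :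
    |(∫ s in (0:ℝ)..t, f s) - ∫ s in (0:ℝ)..t, g s| ≤ ∫ s in (0:ℝ)..lam, |f s - g s| := by
  have hlam := ht.1.trans ht.2
  have hsub : uIcc 0 t ⊆ uIcc 0 lam := by
    rw [uIcc_of_le ht.1, uIcc_of_le hlam]
    exact Icc_subset_Icc_right ht.2
  rw [← intervalIntegral.integral_sub (hf.mono_set hsub) (hg.mono_set hsub)]
  refine (intervalIntegral.abs_integral_le_integral_abs ht.1).trans ?_
  exact intervalIntegral.integral_mono_interval le_rfl ht.1 ht.2
    (Eventually.of_forall fun _ => abs_nonneg _) (hf.sub hg).abs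

theorem primitive_mem_Icc {lam : ℝ} {f : ℝ → ℝ} (hf : IntervalIntegrable f volume 0 lam)
    (hf01 : ∀ᵐ t, t ∈ Ioc 0 lam → f t ∈ Icc (0:ℝ) 1) {t : ℝ} (ht : t ∈ Icc 0 lam) :
    (∫ s in (0:ℝ)..t, f s) ∈ Icc 0 lam := by
  have hlam := ht.1.trans ht.2
  have hsub : uIcc 0 t ⊆ uIcc 0 lam := by
    rw [uIcc_of_le ht.1, uIcc_of_le hlam]
    exact Icc_subset_Icc_right ht.2
  have hae : ∀ᵐ s ∂volume.restrict (Ioc 0 t), f s ∈ Icc (0:ℝ) 1 := by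
    rw [ae_restrict_iff' measurableSet_Ioc]
    filter_upwards [hf01] with s hs hst using hs ⟨hst.1, hst.2.trans ht.2⟩
  constructor
  · rw [intervalIntegral.integral_of_le ht.1]
    exact integral_nonneg_of_ae (hae.mono fun s hs => hs.1)
  · have h1 : ∫ s in (0:ℝ)..t, f s ≤ ∫ _s in (0:ℝ)..t, (1:ℝ) := by
      rw [intervalIntegral.integral_of_le ht.1, intervalIntegral.integral_of_le ht.1]
      exact integral_mono_ae (hf.mono_set hsub).1 (intervalIntegrable_const (c := (1:ℝ))).1
        (hae.mono fun s hs => hs.2)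
    simp only [intervalIntegral.integral_const, sub_zero, smul_eq_mul, mul_one] at h1
    exact h1.trans ht.2

theorem intervalIntegrable_mul_sq_sub_primitive {lam : ℝ} {f : ℝ → ℝ}
    (hf : IntervalIntegrable f volume 0 lam) :
    IntervalIntegrable (fun y => f y * (y - lam * ∫ s in (0:ℝ)..y, f s) ^ 2) volume 0 lam := by
  refine hf.mul_continuousOn ?_
  have := intervalIntegral.continuousOn_primitive_interval' hf left_mem_uIcc
  fun_prop

/-- The lower order part of the energy is Lipschitz in the slope with respect to the `L¹` norm. -/
theorem abs_integral_mul_sq_sub_primitive_sub_le {lam : ℝ} (hlam : 0 ≤ lam) {f g : ℝ → ℝ}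
    (hf : IntervalIntegrable f volume 0 lam) (hg : IntervalIntegrable g volume 0 lam)
    (hf01 : ∀ᵐ t, t ∈ Ioc 0 lam → f t ∈ Icc (0:ℝ) 1)
    (hg01 : ∀ᵐ t, t ∈ Ioc 0 lam → g t ∈ Icc (0:ℝ) 1) :
    |(∫ y in (0:ℝ)..lam, f y * (y - lam * ∫ s in (0:ℝ)..y, f s) ^ 2) -
        ∫ y in (0:ℝ)..lam, g y * (y - lam * ∫ s in (0:ℝ)..y, g s) ^ 2| ≤
      ((lam + lam ^ 2) ^ 2 + 2 * (lam + lam ^ 2) * lam ^ 2) *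
        ∫ y in (0:ℝ)..lam, |f y - g y| := by
  set η := ∫ y in (0:ℝ)..lam, |f y - g y| with hη
  set Q := lam + lam ^ 2 with hQ
  have hfg : IntervalIntegrable (fun y => |f y - g y|) volume 0 lam := (hf.sub hg).abs
  rw [← intervalIntegral.integral_sub (intervalIntegrable_mul_sq_sub_primitive hf)
    (intervalIntegrable_mul_sq_sub_primitive hg)]
  have hbound : ∀ᵐ y, y ∈ Ioc 0 lam → ‖f y * (y - lam * ∫ s in (0:ℝ)..y, f s) ^ 2 -
      g y * (y - lam * ∫ s in (0:ℝ)..y, g s) ^ 2‖ ≤ Q ^ 2 * |f y - g y| + 2 * Q * (lam * η) := by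
    filter_upwards [hg01] with y hy1 hy
    have hg1 := hy1 hy
    have hyI : y ∈ Icc 0 lam := ⟨hy.1.le, hy.2⟩
    have hF := primitive_mem_Icc hf hf01 hyI
    have hG := primitive_mem_Icc hg hg01 hyI
    have hd := abs_primitive_sub_le hf hg hyI
    rw [← hη] at hd
    set F := ∫ s in (0:ℝ)..y, f s
    set G := ∫ s in (0:ℝ)..y, g s
    have hu : ∀ z ∈ Icc 0 lam, |y - lam * z| ≤ Q := fun z hz => by
      have h1 : lam * z ≤ lam * lam := mul_le_mul_of_nonneg_left hz.2 hlam
      have h2 : 0 ≤ lam * z := mul_nonneg hlam hz.1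
      rw [abs_le]
      constructor <;> nlinarith [hyI.1, hyI.2]
    have hsplit : f y * (y - lam * F) ^ 2 - g y * (y - lam * G) ^ 2 =
        (f y - g y) * (y - lam * F) ^ 2 +
          g y * (((y - lam * F) + (y - lam * G)) * (lam * (G - F))) := by ring
    rw [hsplit, Real.norm_eq_abs]
    refine (abs_add_le _ _).trans (add_le_add ?_ ?_)
    · rw [abs_mul, abs_pow, mul_comm]
      exact mul_le_mul_of_nonneg_right (pow_le_pow_left₀ (abs_nonneg _) (hu F hF) 2)
        (abs_nonneg _)
    · rw [abs_mul, abs_mul, abs_mul, abs_of_nonneg hlam, abs_sub_comm G F]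
      have h1 : |g y| ≤ 1 := abs_le.mpr ⟨by linarith [hg1.1], hg1.2⟩
      have h2 : |y - lam * F + (y - lam * G)| ≤ 2 * Q :=
        (abs_add_le _ _).trans (by linarith [hu F hF, hu G hG])
      have h3 : lam * |F - G| ≤ lam * η := mul_le_mul_of_nonneg_left hd hlam
      have h4 : |y - lam * F + (y - lam * G)| * (lam * |F - G|) ≤ 2 * Q * (lam * η) :=
        mul_le_mul h2 h3 (by positivity) ((abs_nonneg _).trans h2)
      exact (mul_le_of_le_one_left (by positivity) h1).trans h4
  refine (intervalIntegral.norm_integral_le_of_norm_le hlam hbound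
    ((hfg.const_mul _).add intervalIntegrable_const)).trans (le_of_eq ?_)
  rw [intervalIntegral.integral_add (hfg.const_mul _) intervalIntegrable_const,
    intervalIntegral.integral_const_mul, intervalIntegral.integral_const, ← hη]
  simp only [sub_zero, smul_eq_mul]
  ring

/-- Limsup (recovery sequence) inequality for the rescaled foundation energies
`V_ε[h] = ∫₀^λ (ε/2 (h'')² + (1/ε) W*(h') + (μ h'/2)(y-λh)²) dy`: for every
continuous piecewise affine `h` with `h(0)=0`, `h(λ)=1`, derivative `Dh` a
`{0,1}`-valued step function with exactly `k` jumps, and every `εₙ → 0`, there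
is a recovery sequence `hₙ ∈ H²(0,λ)` with `hₙ' ≥ 0` a.e., `hₙ(0)=0`,
`hₙ(λ)=1`, converging to `h` in `H¹(0,λ)`, whose energies converge to
`k C_{W*} + (μ/2)∫₀^λ Dh (y-λh)² dy`. -/
theorem stmt_9
    (lam μ : ℝ) (hlam : 1 ≤ lam) (hμ : 0 < μ)
    (Wstar : ℝ → ℝ)
    (hWs_cont : ContinuousOn Wstar (Ici 0))
    (hWs_nonneg : ∀ H : ℝ, 0 ≤ H → 0 ≤ Wstar H)
    (hWs_zero : ∀ H : ℝ, 0 ≤ H → (Wstar H = 0 ↔ H = 0 ∨ H = 1))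
    (C M : ℝ) (hC : 0 < C) (hM : 1 < M)
    (hgrowth : ∀ H : ℝ, M ≤ H → C * H ^ 2 ≤ Wstar H)
    (h Dh : ℝ → ℝ) (k : ℕ)
    (hDh_int : IntervalIntegrable Dh volume 0 lam)
    (hstep : IsStepOn lam Dh k)
    (hrep : ∀ t ∈ Icc (0:ℝ) lam, h t = ∫ s in (0:ℝ)..t, Dh s)
    (hb0 : h 0 = 0) (hb1 : h lam = 1)
    (eps : ℕ → ℝ) (heps_pos : ∀ n, 0 < eps n)
    (heps0 : Tendsto eps atTop (nhds 0)) :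
    ∃ hn hd hdd : ℕ → ℝ → ℝ,
      (∀ n, ∀ t ∈ Icc (0:ℝ) lam,
        hn n t = hn n 0 + ∫ s in (0:ℝ)..t, hd n s) ∧
      (∀ n, ∀ t ∈ Icc (0:ℝ) lam,
        hd n t = hd n 0 + ∫ s in (0:ℝ)..t, hdd n s) ∧
      (∀ n, IntervalIntegrable (hd n) volume 0 lam) ∧
      (∀ n, IntervalIntegrable (hdd n) volume 0 lam) ∧
      (∀ n, IntervalIntegrable (fun y => (hdd n y) ^ 2) volume 0 lam) ∧
      (∀ n, IntervalIntegrable (fun y => Wstar (hd n y)) volume 0 lam) ∧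
      (∀ n, ∀ᵐ y ∂(volume.restrict (Ioo (0:ℝ) lam)), 0 ≤ hd n y) ∧
      (∀ n, hn n 0 = 0) ∧ (∀ n, hn n lam = 1) ∧
      Tendsto (fun n => ∫ y in (0:ℝ)..lam, (hn n y - h y) ^ 2)
        atTop (nhds 0) ∧
      Tendsto (fun n => ∫ y in (0:ℝ)..lam, (hd n y - Dh y) ^ 2)
        atTop (nhds 0) ∧
      Tendsto (fun n => ∫ y in (0:ℝ)..lam,
          (eps n / 2 * (hdd n y) ^ 2 + (1 / eps n) * Wstar (hd n y) +
            μ * hd n y / 2 * (y - lam * hn n y) ^ 2)) atTop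
        (nhds ((k : ℝ) * (∫ τ in (0:ℝ)..1, Real.sqrt (2 * Wstar τ)) +
          μ / 2 * ∫ y in (0:ℝ)..lam, Dh y * (y - lam * h y) ^ 2)) := by
  obtain ⟨y, c, hy, hy0, hylam, hc, hjump, hDh⟩ := hstep
  have hlam0 : 0 ≤ lam := by linarith
  have hW0 : Wstar 0 = 0 := (hWs_zero 0 le_rfl).mpr (Or.inl rfl)
  have hW1 : Wstar 1 = 0 := (hWs_zero 1 zero_le_one).mpr (Or.inr rfl)
  set Y : ℕ → ℝ := fun m => y ⟨min m (k + 1), by omega⟩ with hY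
  set e : ℕ → ℝ := fun m => c ⟨min m k, by omega⟩ with he
  have hYc : ∀ (i : ℕ) (hi : i < k + 1), Y i = y (Fin.castSucc ⟨i, hi⟩) := fun i hi => by
    simp only [hY]
    congr 1
    ext
    simp only [Fin.val_castSucc]
    omega
  have hYs : ∀ (i : ℕ) (hi : i < k + 1), Y (i + 1) = y (Fin.succ ⟨i, hi⟩) := fun i hi => by
    simp only [hY]
    congr 1
    ext
    simp only [Fin.val_succ]
    omega
  have hec : ∀ (i : ℕ) (hi : i < k + 1), e i = c ⟨i, hi⟩ := fun i hi => by
    simp only [he]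
    congr 1
    ext
    dsimp only
    omega
  have hY0 : Y 0 = 0 := by
    rw [hYc 0 (by omega), ← hy0]
    rfl
  have hYlam : Y (k + 1) = lam := by
    rw [hYs k (by omega), ← hylam]
    rfl
  have he01 : ∀ i ≤ k, e i = 0 ∨ e i = 1 := fun i _ => hc _
  have hej : ∀ i < k, e i ≠ e (i + 1) := fun i hi => by
    rw [hec i (by omega), hec (i + 1) (by omega)]
    exact hjump ⟨i, hi⟩
  have hYD : ∀ i ≤ k, ∀ᵐ t, t ∈ Ioo (Y i) (Y (i + 1)) → Dh t = e i := fun i hi => by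
    have := hDh ⟨i, by omega⟩
    rw [ae_restrict_iff' measurableSet_Ioo] at this
    rwa [hYc i (by omega), hYs i (by omega), hec i (by omega)]
  have hYlt : ∀ i ≤ k, Y i < Y (i + 1) := fun i hi => by
    rw [hYc i (by omega), hYs i (by omega)]
    exact hy Fin.castSucc_lt_succ
  have hYle : ∀ i j, i ≤ j → j ≤ k + 1 → Y i ≤ Y j := fun i j hij hj =>
    hy.monotone (Fin.mk_le_mk.mpr (by omega))
  obtain ⟨d, hd, hgap⟩ : ∃ d > 0, ∀ i ≤ k, Y i + d ≤ Y (i + 1) := by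
    obtain ⟨j, hj, hmin⟩ := (Finset.range (k + 1)).exists_min_image (fun i => Y (i + 1) - Y i)
      ⟨0, by simp⟩
    refine ⟨Y (j + 1) - Y j, sub_pos.mpr (hYlt j ?_), fun i hi => ?_⟩
    · have := Finset.mem_range.mp hj
      omega
    · have := hmin i (Finset.mem_range.mpr (by omega))
      linarith
  have hDh01 : ∀ᵐ t, t ∈ Ioc 0 lam → Dh t ∈ Icc (0:ℝ) 1 := by
    filter_upwards [ae_exists_mem_Ioo_of_forall_ae hY0 hYlam hYle hYD] with t ht hmem
    obtain ⟨j, hj, -, h2⟩ := ht hmem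
    rw [h2]
    rcases he01 j hj with h | h <;> rw [h] <;> simp
  have hDh1 : ∫ t in (0:ℝ)..lam, Dh t = 1 := by
    rw [← hrep lam (right_mem_Icc.mpr hlam0), hb1]
  set E := ∫ τ in (0:ℝ)..1, √(2 * Wstar τ) with hE
  have hex : ∀ n, ∃ p q : ℝ → ℝ, Continuous p ∧ (∀ t, p t ∈ Icc (0:ℝ) 1) ∧ Measurable q ∧
      (∃ B, ∀ t, |q t| ≤ B) ∧ (∀ s t, ∫ u in s..t, q u = p t - p s) ∧
      (∫ t in (0:ℝ)..lam, p t = 1) ∧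
      (2 * √(eps n) ≤ d → (∫ t in (0:ℝ)..lam, |p t - Dh t| ≤ k * (2 * √(eps n))) ∧
      |(∫ t in (0:ℝ)..lam, (eps n / 2 * q t ^ 2 + 1 / eps n * Wstar (p t))) - k * E| ≤
        k * √(2 * eps n)) := fun n => by
    by_cases hn : 2 * √(eps n) ≤ d
    · obtain ⟨p, q, h1, h2, h3, h4, h5, h6, h7, h8⟩ := exists_smoothed_step hWs_cont hWs_nonneg
        hW0 hW1 hY0 hYlam hgap he01 hej hYD (heps_pos n) hn
      exact ⟨p, q, h1, h2, h3, h4, h5, h6.trans hDh1, fun _ => ⟨h7, h8⟩⟩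
    · refine ⟨fun _ => lam⁻¹, fun _ => 0, continuous_const,
        fun t => ⟨inv_nonneg.mpr hlam0, inv_le_one_of_one_le₀ hlam⟩, measurable_const,
        ⟨0, by simp⟩, by simp, ?_, fun h => absurd h hn⟩
      have : lam ≠ 0 := by linarith
      simp [this]
  choose p q hpc hp01 hqm hqb hftc hp1 hbd using hex
  have hpi : ∀ n s t, IntervalIntegrable (p n) volume s t := fun n s t =>
    (hpc n).intervalIntegrable s t
  have hqi : ∀ n s t, IntervalIntegrable (q n) volume s t := fun n s t => by
    obtain ⟨B, hB⟩ := hqb n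
    exact intervalIntegrable_of_measurable_of_abs_le (hqm n) hB s t
  have hq2i : ∀ n s t, IntervalIntegrable (fun y => q n y ^ 2) volume s t := fun n s t => by
    obtain ⟨B, hB⟩ := hqb n
    refine intervalIntegrable_of_measurable_of_abs_le ((hqm n).pow_const 2) (B := B ^ 2)
      (fun x => ?_) s t
    rw [abs_pow]
    exact pow_le_pow_left₀ (abs_nonneg _) (hB _) 2
  have hWi : ∀ n s t, IntervalIntegrable (fun y => Wstar (p n y)) volume s t := fun n s t =>
    (hWs_cont.comp_continuous (hpc n) fun t => (hp01 n t).1).intervalIntegrable _ _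
  set η : ℕ → ℝ := fun n => ∫ t in (0:ℝ)..lam, |p n t - Dh t| with hη
  have hη0 : ∀ n, 0 ≤ η n := fun n =>
    intervalIntegral.integral_nonneg hlam0 fun _ _ => abs_nonneg _
  have hsq : Tendsto (fun n => √(eps n)) atTop (nhds 0) := by
    simpa using heps0.sqrt
  have hev : ∀ᶠ n in atTop, 2 * √(eps n) ≤ d := by
    filter_upwards [hsq.eventually_le_const (half_pos hd)] with n hn
    linarith
  have hηlim : Tendsto η atTop (nhds 0) := by
    refine squeeze_zero' (Eventually.of_forall hη0) (hev.mono fun n hn => (hbd n hn).1) ?_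
    simpa using (hsq.const_mul 2).const_mul (k : ℝ)
  have h_int : ∀ t ∈ Icc 0 lam, ∀ n, |(∫ s in (0:ℝ)..t, p n s) - h t| ≤ η n := fun t ht n => by
    rw [hrep t ht]
    exact abs_primitive_sub_le (hpi n _ _) hDh_int ht
  have hlocal : Tendsto (fun n => ∫ t in (0:ℝ)..lam,
      (eps n / 2 * q n t ^ 2 + 1 / eps n * Wstar (p n t))) atTop (nhds (k * E)) := by
    rw [tendsto_iff_dist_tendsto_zero]
    refine squeeze_zero' (Eventually.of_forall fun _ => dist_nonneg)
      (hev.mono fun n hn => (hbd n hn).2) ?_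
    simpa using ((heps0.const_mul 2).sqrt).const_mul (k : ℝ)
  have hlower : Tendsto (fun n => ∫ y in (0:ℝ)..lam,
      p n y * (y - lam * ∫ s in (0:ℝ)..y, p n s) ^ 2) atTop
      (nhds (∫ y in (0:ℝ)..lam, Dh y * (y - lam * h y) ^ 2)) := by
    have hcongr : ∫ y in (0:ℝ)..lam, Dh y * (y - lam * h y) ^ 2 =
        ∫ y in (0:ℝ)..lam, Dh y * (y - lam * ∫ s in (0:ℝ)..y, Dh s) ^ 2 := by
      refine intervalIntegral.integral_congr fun t ht => ?_
      rw [uIcc_of_le hlam0] at ht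
      simp only [hrep t ht]
    rw [hcongr, tendsto_iff_dist_tendsto_zero]
    refine squeeze_zero (fun _ => dist_nonneg) (fun n =>
      abs_integral_mul_sq_sub_primitive_sub_le hlam0 (hpi n _ _) hDh_int
        (Eventually.of_forall fun t _ => hp01 n t) hDh01) ?_
    simpa using hηlim.const_mul ((lam + lam ^ 2) ^ 2 + 2 * (lam + lam ^ 2) * lam ^ 2)
  refine ⟨fun n t => ∫ s in (0:ℝ)..t, p n s, p, q, fun n t _ => by simp,
    fun n t _ => by rw [hftc]; ring, fun n => hpi n _ _, fun n => hqi n _ _, fun n => hq2i n _ _,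
    fun n => hWi n _ _, fun n => Eventually.of_forall fun t => (hp01 n t).1, fun n => by simp,
    hp1, ?_, ?_, ?_⟩
  · refine squeeze_zero (g := fun n => η n ^ 2 * |lam - 0|)
      (fun n => intervalIntegral.integral_nonneg hlam0 fun _ _ => sq_nonneg _) (fun n => ?_) ?_
    · refine (Real.le_norm_self _).trans
        (intervalIntegral.norm_integral_le_of_norm_le_const fun t ht => ?_)
      rw [uIoc_of_le hlam0] at ht
      rw [norm_pow, Real.norm_eq_abs]
      exact pow_le_pow_left₀ (abs_nonneg _) (h_int t ⟨ht.1.le, ht.2⟩ n) 2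
    · simpa using (hηlim.pow 2).mul_const |lam - 0|
  · refine squeeze_zero (fun n => intervalIntegral.integral_nonneg hlam0 fun _ _ => sq_nonneg _)
      (fun n => ?_) hηlim
    refine (Real.le_norm_self _).trans (intervalIntegral.norm_integral_le_of_norm_le hlam0 ?_
      ((hpi n _ _).sub hDh_int).abs)
    filter_upwards [hDh01] with t ht hmem
    have h1 := ht hmem
    have h2 := hp01 n t
    have h3 : |p n t - Dh t| ≤ 1 :=
      abs_le.mpr ⟨by linarith [h1.2, h2.1], by linarith [h1.1, h2.2]⟩
    rw [norm_pow, Real.norm_eq_abs, sq]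
    exact mul_le_of_le_one_left (abs_nonneg _) h3
  · refine (hlocal.add (hlower.const_mul (μ / 2))).congr fun n => ?_
    rw [← intervalIntegral.integral_const_mul, ← intervalIntegral.integral_add]
    · refine intervalIntegral.integral_congr fun t _ => ?_
      dsimp only
      ring
    · exact ((hq2i n _ _).const_mul _).add ((hWi n _ _).const_mul _)
    · exact (intervalIntegrable_mul_sq_sub_primitive (hpi n _ _)).const_mul _
end

section
/- Let λ > 1 and let h : [0,λ] → ℝ be Lipschitz with h′(y) ∈ {0,1} for a.e. y ∈ (0,λ), h(0) = 0 and h(λ) = 1. Then ∫₀^λ h′(y)·(y − λ·h(y))² dy > 0. -/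
open MeasureTheory Set intervalIntegral

/-- A function `y ↦ y - c ∫ₐʸ f` vanishing at both endpoints satisfies
`∫ g² = c ∫ f g²`, because `∫ (g³)' = 0`. -/
theorem integral_sq_eq_mul_integral_mul_sq {f : ℝ → ℝ} {a b c : ℝ}
    (hf : IntervalIntegrable f volume a b) {g : ℝ → ℝ}
    (hg : ∀ y, g y = y - c * ∫ s in a..y, f s)
    (hga : g a = 0) (hgb : g b = 0) :
    ∫ y in a..b, g y ^ 2 = c * ∫ y in a..b, f y * g y ^ 2 := by
  have hAC : AbsolutelyContinuousOnInterval g a b := by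
    rw [funext hg]
    exact contDiff_id.contDiffOn.absolutelyContinuousOnInterval.sub
      ((hf.absolutelyContinuousOnInterval_intervalIntegral left_mem_uIcc).const_mul c)
  have hcont : ContinuousOn (fun y => g y ^ 2) (uIcc a b) := hAC.continuousOn.pow 2
  have hcube := ((hAC.mul hAC).mul hAC).integral_deriv_eq_sub
  have hderiv : ∀ᵐ y, y ∈ uIoc a b →
      deriv (g * g * g) y = 3 * (g y ^ 2 - c * (f y * g y ^ 2)) := by
    filter_upwards [hf.ae_hasDerivAt_integral] with y hy hyab
    have hg' : HasDerivAt g (1 - c * f y) y := by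
      rw [funext hg]
      exact (hasDerivAt_id y).sub
        ((hy (uIoc_subset_uIcc hyab) a left_mem_uIcc).const_mul c)
    rw [((hg'.mul hg').mul hg').deriv]
    simp only [Pi.mul_apply]
    ring
  rw [integral_congr_ae hderiv, intervalIntegral.integral_const_mul,
    intervalIntegral.integral_sub hcont.intervalIntegrable ((hf.mul_continuousOn hcont).const_mul c),
    intervalIntegral.integral_const_mul] at hcube
  simp only [Pi.mul_apply, hga, hgb] at hcube
  linarith

/-- If `y - c ∫ₐʸ f` vanishes identically on `[a, b]`, then `c f = 1` almost everywhere there. -/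
theorem ae_mul_eq_one_of_sub_mul_integral_eq_zero {f : ℝ → ℝ} {a b c : ℝ}
    (hf : IntervalIntegrable f volume a b)
    (hzero : ∀ y ∈ Ioo a b, y - c * ∫ s in a..y, f s = 0) :
    ∀ᵐ y, y ∈ Ioo a b → c * f y = 1 := by
  filter_upwards [hf.ae_hasDerivAt_integral] with y hy hyab
  have hab : a ≤ b := (hyab.1.trans hyab.2).le
  have hg' := (hasDerivAt_id y).sub
    ((hy (uIcc_of_le hab ▸ Ioo_subset_Icc_self hyab) a left_mem_uIcc).const_mul c)
  have hloc : (fun y => y - c * ∫ s in a..y, f s) =ᶠ[nhds y] fun _ => 0 :=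
    Filter.eventually_of_mem (Ioo_mem_nhds hyab.1 hyab.2) hzero
  have := ((hasDerivAt_const y (0 : ℝ)).congr_of_eventuallyEq hloc).unique hg'
  linarith

/-- For `λ > 1`, any Lipschitz (absolutely continuous with bounded derivative)
`h : [0,λ] → ℝ` with `h'(y) ∈ {0,1}` a.e., `h(0) = 0` and `h(λ) = 1` has
strictly positive foundation energy: `∫₀^λ h'(y)(y - λh(y))² dy > 0`. -/
theorem stmt_12
    (lam : ℝ) (hlam : 1 < lam)
    (h h' : ℝ → ℝ)
    (hmeas : Measurable h')
    (hval : ∀ᵐ y ∂(volume.restrict (Ioo (0:ℝ) lam)), h' y = 0 ∨ h' y = 1)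
    (hrep : ∀ t ∈ Icc (0:ℝ) lam, h t = ∫ s in (0:ℝ)..t, h' s)
    (hb0 : h 0 = 0) (hb1 : h lam = 1) :
    0 < ∫ y in (0:ℝ)..lam, h' y * (y - lam * h y) ^ 2 := by
  have hlam0 : 0 < lam := by linarith
  have hint : IntervalIntegrable h' volume 0 lam := by
    by_contra hn
    have := hrep lam (right_mem_Icc.2 hlam0.le)
    rw [integral_undef hn, hb1] at this
    exact one_ne_zero this
  set g : ℝ → ℝ := fun y => y - lam * ∫ s in (0:ℝ)..y, h' s with hg
  have hgh : ∀ y ∈ Icc 0 lam, g y = y - lam * h y := fun y hy => by rw [hrep y hy]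
  have hg0 : g 0 = 0 := by simp [hg]
  have hgl : g lam = 0 := by rw [hgh lam (right_mem_Icc.2 hlam0.le), hb1]; ring
  have hcongr : ∫ y in (0:ℝ)..lam, h' y * (y - lam * h y) ^ 2
      = ∫ y in (0:ℝ)..lam, h' y * g y ^ 2 :=
    integral_congr fun y hy => by
      rw [uIcc_of_le hlam0.le] at hy
      simp only [hgh y hy]
  have hcont : ContinuousOn g (Icc 0 lam) := by
    rw [← uIcc_of_le hlam0.le]
    exact continuousOn_id.sub (continuousOn_const.mul
      (hint.absolutelyContinuousOnInterval_intervalIntegral left_mem_uIcc).continuousOn)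
  have hne : ∃ y ∈ Icc 0 lam, 0 < g y ^ 2 := by
    by_contra! hall
    have hone := ae_mul_eq_one_of_sub_mul_integral_eq_zero hint
      fun y hy => pow_eq_zero_iff two_ne_zero |>.1
        ((hall y (Ioo_subset_Icc_self hy)).antisymm (sq_nonneg _))
    have hnot : ∀ᵐ y, y ∉ Ioo 0 lam := by
      filter_upwards [hone, (ae_restrict_iff' measurableSet_Ioo).1 hval] with y h1 h2 hy
      have := h1 hy
      rcases h2 hy with h3 | h3 <;> rw [h3] at this <;> linarith
    have hvol := measure_eq_zero_iff_ae_notMem.2 hnot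
    rw [Real.volume_Ioo, ENNReal.ofReal_eq_zero] at hvol
    linarith
  have hpos : 0 < ∫ y in (0:ℝ)..lam, g y ^ 2 :=
    integral_pos hlam0 (hcont.pow 2) (fun y _ => sq_nonneg _) hne
  rw [integral_sq_eq_mul_integral_mul_sq hint (fun _ => rfl) hg0 hgl] at hpos
  rw [hcongr]
  exact pos_of_mul_pos_right hpos hlam0.le
end

section
/- Let C > 0 and μ > 0. For λ > 1 define Vₙ(λ) := n·C + μ(λ−1)²/(6n²) for positive integers n, x(λ) := (μ(λ−1)²/(3C))^{1/3}, and the crack number n*(λ) by: n*(λ) := 1 if x(λ) < 1; otherwise, with m := ⌊x(λ)⌋, n*(λ) := m if V_m(λ) ≤ V_{m+1}(λ) and n*(λ) := m+1 otherwise. Then n*(λ) is nondecreasing in λ: if 1 < λ₁ ≤ λ₂ then n*(λ₁) ≤ n*(λ₂). -/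
/-- Energy of the optimal `n`-crack configuration at load `lam`. -/
noncomputable def Vn (C μ lam : ℝ) (n : ℕ) : ℝ :=
  (n : ℝ) * C + μ * (lam - 1) ^ 2 / (6 * (n : ℝ) ^ 2)

/-- The continuous minimizer `x(λ) = (μ(λ-1)²/(3C))^{1/3}`. -/
noncomputable def xload (C μ lam : ℝ) : ℝ :=
  (μ * (lam - 1) ^ 2 / (3 * C)) ^ ((1 : ℝ) / 3)

/-- The crack number `n*(λ)`: `1` if `x(λ) < 1`; otherwise `m = ⌊x(λ)⌋` if
`V_m(λ) ≤ V_{m+1}(λ)` and `m+1` otherwise. -/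
noncomputable def nstar (C μ lam : ℝ) : ℕ :=
  if xload C μ lam < 1 then 1
  else if Vn C μ lam ⌊xload C μ lam⌋₊ ≤ Vn C μ lam (⌊xload C μ lam⌋₊ + 1)
    then ⌊xload C μ lam⌋₊
    else ⌊xload C μ lam⌋₊ + 1

theorem xload_le_xload {C μ a b : ℝ} (hC : 0 < C) (hμ : 0 < μ) (ha : 1 ≤ a) (hab : a ≤ b) :
    xload C μ a ≤ xload C μ b := by
  have : 0 ≤ a - 1 := sub_nonneg.2 ha
  unfold xload
  gcongr

/-- If `n` cracks are no worse than `n + 1` at some load, the same holds at any smaller load. -/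
theorem Vn_le_Vn_succ_of_le {C μ a b : ℝ} (hμ : 0 < μ) (ha : 1 ≤ a) (hab : a ≤ b) {n : ℕ}
    (hn : 0 < n) (h : Vn C μ b n ≤ Vn C μ b (n + 1)) : Vn C μ a n ≤ Vn C μ a (n + 1) := by
  have ha' : 0 ≤ a - 1 := sub_nonneg.2 ha
  have hn' : (0 : ℝ) < n := Nat.cast_pos.2 hn
  have hsq : μ * (a - 1) ^ 2 ≤ μ * (b - 1) ^ 2 := by gcongr
  have hinv : (6 * ((n : ℝ) + 1) ^ 2)⁻¹ ≤ (6 * (n : ℝ) ^ 2)⁻¹ := by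
    gcongr
    linarith
  have hmul := mul_le_mul_of_nonneg_right hsq (sub_nonneg.2 hinv)
  simp only [Vn, div_eq_mul_inv, Nat.cast_add, Nat.cast_one] at h ⊢
  linarith

theorem one_le_nstar (C μ lam : ℝ) : 1 ≤ nstar C μ lam := by
  unfold nstar
  split_ifs with hx
  · exact le_rfl
  · exact Nat.floor_pos.2 (not_lt.1 hx)
  · exact Nat.le_add_left _ _

/-- The number of cracks `n*(λ)` in an energy-minimizing configuration is
nondecreasing in the load `λ`: if `1 < λ₁ ≤ λ₂` then `n*(λ₁) ≤ n*(λ₂)`. -/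
theorem stmt_17
    (C μ : ℝ) (hC : 0 < C) (hμ : 0 < μ)
    (lam₁ lam₂ : ℝ) (h₁ : 1 < lam₁) (h₁₂ : lam₁ ≤ lam₂) :
    nstar C μ lam₁ ≤ nstar C μ lam₂ := by
  have hx := xload_le_xload hC hμ h₁.le h₁₂
  by_cases hx₁ : xload C μ lam₁ < 1
  · simpa [nstar, hx₁] using one_le_nstar C μ lam₂
  have hx₂ : ¬ xload C μ lam₂ < 1 := fun h => hx₁ (hx.trans_lt h)
  have hpos : 0 < ⌊xload C μ lam₁⌋₊ := Nat.floor_pos.2 (not_lt.1 hx₁)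
  unfold nstar
  rw [if_neg hx₁, if_neg hx₂]
  rcases (Nat.floor_mono hx).eq_or_lt with heq | hlt
  · rw [← heq]
    have key := Vn_le_Vn_succ_of_le (C := C) hμ h₁.le h₁₂ hpos
    split_ifs with hV₁ hV₂ hV₂
    · exact le_rfl
    · exact Nat.le_succ _
    · exact absurd (key hV₂) hV₁
    · exact le_rfl
  · split_ifs <;> omega
end
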